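/- arXiv:2509.08762 — 2 statements merged into one kernel-verified Lean document; each statement's English description precedes it below -/
import Mathlib

section
/- For all integers k, d, c ≥ 0 there exist integers ℓ₁, ℓ₂ ≥ 0 with the following property: for every finite simple graph G containing no ℓ₁-subdivision of the uniform binary tree H_d as a subgraph, and all sets S, T ⊆ V(G), either (i) there are k+1 paths of G between S and T, pairwise at distance greater than c in G, or (ii) there is a set X ⊆ V(G) with |X| ≤ k such that every path of G between S and T contains a vertex at distance at most ℓ₂ in G from some member of X. -/
open SimpleGraph

/-- The distance in a graph `G` between two sets of vertices (`⊤` if no connecting walk). -/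
noncomputable def eSetDist {V : Type*} (G : SimpleGraph V) (A B : Set V) : ℕ∞ :=
  sInf {n : ℕ∞ | ∃ (a b : V) (w : G.Walk a b), a ∈ A ∧ b ∈ B ∧ (w.length : ℕ∞) = n}

/-- The uniform binary tree of depth `d`: vertices are binary strings of length `< d`
(the root is the empty string), and each string is adjacent to its two one-letter
extensions.  For `d ≥ 2` this is exactly the tree `H_d` with a root of degree two, all
other vertices of degree one or three, and all leaves at distance `d-1` from the root. -/
def binTree (d : ℕ) : SimpleGraph {l : List Bool // l.length < d} :=
  SimpleGraph.fromRel (fun a b => ∃ x : Bool, (b : List Bool) = x :: (a : List Bool))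

/-- `G` contains an `n`-subdivision of `H` as a subgraph: there is an injection `f` of the
vertices of `H` into `G` and, for each edge `ab` of `H`, a path of `G` from `f a` to `f b`
of length at least one and at most `n`, these paths being pairwise vertex-disjoint except
for their ends (branch vertices). -/
def HasNSubdivision {V W : Type*} (G : SimpleGraph V) (H : SimpleGraph W) (n : ℕ) : Prop :=
  ∃ (f : W → V) (P : ∀ ⦃a b : W⦄, H.Adj a b → G.Walk (f a) (f b)),
    Function.Injective f ∧
    (∀ a b (h : H.Adj a b), (P h).IsPath) ∧
    (∀ a b (h : H.Adj a b), 1 ≤ (P h).length ∧ (P h).length ≤ n) ∧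
    (∀ a b (h : H.Adj a b), ∀ x ∈ (P h).support, x ∈ Set.range f → x = f a ∨ x = f b) ∧
    (∀ a b a' b' (h : H.Adj a b) (h' : H.Adj a' b'), s(a, b) ≠ s(a', b') →
      ∀ x ∈ (P h).support, x ∈ (P h').support → x ∈ Set.range f)


namespace CM
variable {V : Type*}

/-- there is a walk of length at most `n` -/
def nb (G : SimpleGraph V) (n : ℕ) (x y : V) : Prop := ∃ w : G.Walk x y, w.length ≤ n

/-- there is a walk inside `Z` -/
def cn (G : SimpleGraph V) (Z : Set V) (x y : V) : Prop := ∃ w : G.Walk x y, ∀ u ∈ w.support, u ∈ Z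

/-- there is a walk of length at most `n` inside `Z` -/
def cnb (G : SimpleGraph V) (Z : Set V) (n : ℕ) (x y : V) : Prop :=
  ∃ w : G.Walk x y, (∀ u ∈ w.support, u ∈ Z) ∧ w.length ≤ n

variable {G : SimpleGraph V}

theorem nb.symm {n : ℕ} {x y : V} (h : nb G n x y) : nb G n y x := by
  obtain ⟨w, hw⟩ := h
  exact ⟨w.reverse, by simpa using hw⟩

theorem nb.trans {n m : ℕ} {x y z : V} (h : nb G n x y) (h' : nb G m y z) : nb G (n + m) x z := by
  obtain ⟨w, hw⟩ := h
  obtain ⟨w', hw'⟩ := h'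
  exact ⟨w.append w', by rw [SimpleGraph.Walk.length_append]; omega⟩

theorem nb.mono {n m : ℕ} {x y : V} (h : nb G n x y) (h' : n ≤ m) : nb G m x y := by
  obtain ⟨w, hw⟩ := h
  exact ⟨w, by omega⟩

theorem nb_refl (n : ℕ) (x : V) : nb G n x x := ⟨SimpleGraph.Walk.nil, by simp⟩

theorem nb_adj {x y : V} (h : G.Adj x y) : nb G 1 x y := ⟨h.toWalk, by simp⟩

theorem cn.symm {Z : Set V} {x y : V} (h : cn G Z x y) : cn G Z y x := by
  obtain ⟨w, hw⟩ := h
  exact ⟨w.reverse, by simpa using hw⟩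

theorem cn.trans {Z : Set V} {x y z : V} (h : cn G Z x y) (h' : cn G Z y z) : cn G Z x z := by
  obtain ⟨w, hw⟩ := h
  obtain ⟨w', hw'⟩ := h'
  refine ⟨w.append w', fun u hu => ?_⟩
  rw [SimpleGraph.Walk.mem_support_append_iff] at hu
  exact hu.elim (hw u) (hw' u)

theorem cn.mono {Z Z' : Set V} {x y : V} (h : cn G Z x y) (h' : Z ⊆ Z') : cn G Z' x y := by
  obtain ⟨w, hw⟩ := h
  exact ⟨w, fun u hu => h' (hw u hu)⟩

theorem cn.left {Z : Set V} {x y : V} (h : cn G Z x y) : x ∈ Z := by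
  obtain ⟨w, hw⟩ := h
  exact hw _ w.start_mem_support

theorem cn.right {Z : Set V} {x y : V} (h : cn G Z x y) : y ∈ Z := h.symm.left

theorem cn_refl {Z : Set V} {x : V} (h : x ∈ Z) : cn G Z x x :=
  ⟨SimpleGraph.Walk.nil, by simpa using h⟩

theorem cn_adj {Z : Set V} {x y : V} (h : G.Adj x y) (hx : x ∈ Z) (hy : y ∈ Z) : cn G Z x y :=
  ⟨h.toWalk, by simp [hx, hy]⟩

theorem cnb.symm {Z : Set V} {n : ℕ} {x y : V} (h : cnb G Z n x y) : cnb G Z n y x := by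
  obtain ⟨w, hw, hl⟩ := h
  exact ⟨w.reverse, by simpa using hw, by simpa using hl⟩

theorem cnb.trans {Z : Set V} {n m : ℕ} {x y z : V} (h : cnb G Z n x y) (h' : cnb G Z m y z) :
    cnb G Z (n + m) x z := by
  obtain ⟨w, hw, hl⟩ := h
  obtain ⟨w', hw', hl'⟩ := h'
  refine ⟨w.append w', fun u hu => ?_, by rw [SimpleGraph.Walk.length_append]; omega⟩
  rw [SimpleGraph.Walk.mem_support_append_iff] at hu
  exact hu.elim (hw u) (hw' u)

theorem cnb.mono {Z Z' : Set V} {n m : ℕ} {x y : V} (h : cnb G Z n x y) (h' : Z ⊆ Z')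
    (hm : n ≤ m) : cnb G Z' m x y := by
  obtain ⟨w, hw, hl⟩ := h
  exact ⟨w, fun u hu => h' (hw u hu), by omega⟩

theorem cnb.cn {Z : Set V} {n : ℕ} {x y : V} (h : cnb G Z n x y) : cn G Z x y := by
  obtain ⟨w, hw, hl⟩ := h
  exact ⟨w, hw⟩

theorem cnb.nb {Z : Set V} {n : ℕ} {x y : V} (h : cnb G Z n x y) : nb G n x y := by
  obtain ⟨w, hw, hl⟩ := h
  exact ⟨w, hl⟩

theorem walk_split {x y u : V} (w : G.Walk x y) (hu : u ∈ w.support) :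
    ∃ (p : G.Walk x u) (q : G.Walk u y), p.length + q.length = w.length ∧
      (∀ z ∈ p.support, z ∈ w.support) ∧ (∀ z ∈ q.support, z ∈ w.support) ∧ w = p.append q := by
  obtain ⟨p, q, rfl⟩ := SimpleGraph.Walk.mem_support_iff_exists_append.mp hu
  exact ⟨p, q, by simp, fun z hz => by simp [hz], fun z hz => by simp [hz], rfl⟩

/-- certificate for a subdivided binary tree of depth `n` rooted at `v`, inside the set -/
inductive BT (G : SimpleGraph V) (a : ℕ) : ℕ → V → Set V → Prop
  | leaf (v : V) : BT G a 0 v {v}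
  | node (n : ℕ) (v : V) (x : Bool → V) (A : Bool → Set V) (p : ∀ b, G.Walk v (x b))
      (hB : ∀ b, BT G a n (x b) (A b))
      (hA : ∀ b b' u, u ∈ A b → u ∈ A b' → b = b')
      (hp : ∀ b, (p b).IsPath) (h1 : ∀ b, 1 ≤ (p b).length) (h2 : ∀ b, (p b).length ≤ a)
      (hpA : ∀ b b' u, u ∈ (p b).support → u ∈ A b' → u = x b' ∧ b = b')
      (hpp : ∀ b b' u, b ≠ b' → u ∈ (p b).support → u ∈ (p b').support → u = v) :
      BT G a (n + 1) v {u | ∃ b, u ∈ A b ∨ u ∈ (p b).support}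

theorem BT.root_mem {a n : ℕ} {v : V} {A : Set V} (h : BT G a n v A) : v ∈ A := by
  cases h with
  | leaf => simp
  | node n v x A p => exact ⟨true, Or.inr (SimpleGraph.Walk.start_mem_support _)⟩

theorem BT.trunc {a n : ℕ} {v : V} {A : Set V} (h : BT G a n v A) :
    ∀ m ≤ n, ∃ A' ⊆ A, BT G a m v A' := by
  induction h with
  | leaf v =>
    intro m hm
    obtain rfl : m = 0 := by omega
    exact ⟨_, subset_rfl, BT.leaf v⟩
  | node n v x A p hB hA hp h1 h2 hpA hpp ih =>
    intro m hm
    rcases m with _ | m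
    · refine ⟨{v}, ?_, BT.leaf v⟩
      rintro _ rfl
      exact ⟨true, Or.inr (SimpleGraph.Walk.start_mem_support _)⟩
    · choose A' hA' hB' using fun b => ih b m (by omega)
      refine ⟨_, ?_, BT.node m v x A' p hB' ?_ hp h1 h2 ?_ hpp⟩
      · rintro u ⟨b, hb⟩
        exact ⟨b, hb.imp (fun h => hA' b h) id⟩
      · exact fun b b' u h h' => hA b b' u (hA' b h) (hA' b' h')
      · exact fun b b' u h h' => hpA b b' u h (hA' b' h')

theorem BT.radius {a n : ℕ} {v : V} {A : Set V} (h : BT G a n v A) :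
    ∀ z ∈ A, cnb G A (n * a) v z := by
  induction h with
  | leaf v =>
    rintro z rfl
    exact ⟨SimpleGraph.Walk.nil, by simp, by simp⟩
  | node n v x A p hB hA hp h1 h2 hpA hpp ih =>
    rintro z ⟨b, hb⟩
    rcases hb with hb | hb
    · have e1 : cnb G {u | ∃ b, u ∈ A b ∨ u ∈ (p b).support} a v (x b) :=
        ⟨p b, fun u hu => ⟨b, Or.inr hu⟩, h2 b⟩
      have e2 := (ih b z hb).mono (Z' := {u | ∃ b, u ∈ A b ∨ u ∈ (p b).support})
        (fun u hu => ⟨b, Or.inl hu⟩) le_rfl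
      exact (e1.trans e2).mono subset_rfl (by ring_nf; omega)
    · obtain ⟨q, r, hl, hq, -, -⟩ := walk_split (p b) hb
      refine ⟨q, fun u hu => ⟨b, Or.inr (hq u hu)⟩, ?_⟩
      have := h2 b
      nlinarith

theorem BT.embed {a n : ℕ} {v : V} {A : Set V} (h : BT G a n v A) :
    ∃ (g : List Bool → V) (Q : List Bool → Set V), g [] = v ∧
      (∀ r, r.length ≤ n → g r ∈ A) ∧
      (∀ r s, r.length ≤ n → s.length ≤ n → g r = g s → r = s) ∧
      (∀ c, c ≠ [] → c.length ≤ n → ∃ p : G.Walk (g c.dropLast) (g c), p.IsPath ∧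
        1 ≤ p.length ∧ p.length ≤ a ∧ ∀ u ∈ p.support, u ∈ Q c) ∧
      (∀ c, c ≠ [] → c.length ≤ n → Q c ⊆ A) ∧
      (∀ c r, c ≠ [] → c.length ≤ n → r.length ≤ n → g r ∈ Q c → r = c ∨ r = c.dropLast) ∧
      (∀ c c', c ≠ [] → c' ≠ [] → c.length ≤ n → c'.length ≤ n → c ≠ c' →
        ∀ z, z ∈ Q c → z ∈ Q c' → ∃ r, r.length ≤ n ∧ z = g r) := by
  induction h with
  | leaf v =>
    refine ⟨fun _ => v, fun _ => ∅, rfl, by simp, ?_, ?_, ?_, ?_, ?_⟩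
    · intro r s hr hs _
      rw [List.eq_nil_of_length_eq_zero (l := r) (by omega),
        List.eq_nil_of_length_eq_zero (l := s) (by omega)]
    all_goals
      intro c
      intros
      exfalso
      have : c = [] := List.eq_nil_of_length_eq_zero (by omega)
      contradiction
  | node n v x A p hB hA hp h1 h2 hpA hpp ih =>
    choose g Q hg0 hgA hinj hpath hQA hgQ hQQ using ih
    have hvA : ∀ b, v ∉ A b := by
      intro b hb
      have := (hpA (!b) b v (SimpleGraph.Walk.start_mem_support _) hb).2
      simp at this
    let g' : List Bool → V := fun r => match r with
      | [] => v
      | b :: r => g b r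
    let Q' : List Bool → Set V := fun r => match r with
      | [] => ∅
      | [b] => {u | u ∈ (p b).support}
      | b :: r => Q b r
    refine ⟨g', Q', rfl, ?_, ?_, ?_, ?_, ?_, ?_⟩
    · rintro (_ | ⟨b, r⟩) hr
      · exact ⟨true, Or.inr (SimpleGraph.Walk.start_mem_support _)⟩
      · exact ⟨b, Or.inl (hgA b r (by simpa using hr))⟩
    · rintro (_ | ⟨b, r⟩) (_ | ⟨b', s⟩) hr hs h
      · rfl
      · exact absurd (by rw [show v = g b' s from h]; exact hgA b' s (by simpa using hs)) (hvA b')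
      · exact absurd (by rw [← show g b r = v from h]; exact hgA b r (by simpa using hr)) (hvA b)
      · have h' : g b r = g b' s := h
        obtain rfl : b = b' := hA b b' _ (hgA b r (by simpa using hr))
          (h' ▸ hgA b' s (by simpa using hs))
        rw [hinj b r s (by simpa using hr) (by simpa using hs) h']
    · rintro (_ | ⟨b, _ | ⟨b', r⟩⟩) hc hl
      · exact absurd rfl hc
      · have e : x b = g b [] := (hg0 b).symm
        have this : ∃ q : G.Walk v (g b []), q.IsPath ∧ 1 ≤ q.length ∧ q.length ≤ a ∧
            ∀ u ∈ q.support, u ∈ (p b).support := by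
          rw [← e]
          exact ⟨p b, hp b, h1 b, h2 b, fun u hu => hu⟩
        exact this
      · exact hpath b (b' :: r) (by simp) (by simpa using hl)
    · rintro (_ | ⟨b, _ | ⟨b', r⟩⟩) hc hl
      · exact absurd rfl hc
      · exact fun u hu => ⟨b, Or.inr hu⟩
      · exact fun u hu => ⟨b, Or.inl (hQA b (b' :: r) (by simp) (by simpa using hl) hu)⟩
    · rintro (_ | ⟨b, _ | ⟨b', r⟩⟩) (_ | ⟨b1, s⟩) hc hl hs h
      · exact absurd rfl hc
      · exact absurd rfl hc
      · right; rfl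
      · left
        have h' : g b1 s ∈ (p b).support := h
        obtain ⟨e1, rfl⟩ := hpA b b1 _ h' (hgA b1 s (by simpa using hs))
        rw [← hg0] at e1
        rw [hinj b s [] (by simpa using hs) (by simp) e1]
      · exact absurd (hQA b (b' :: r) (by simp) (by simpa using hl) h) (hvA b)
      · have h' : g b1 s ∈ Q b (b' :: r) := h
        obtain rfl : b1 = b := hA _ _ _ (hgA b1 s (by simpa using hs))
          (hQA b (b' :: r) (by simp) (by simpa using hl) h')
        rcases hgQ b1 (b' :: r) s (by simp) (by simpa using hl) (by simpa using hs) h' with e | e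
        · left; rw [e]
        · right; rw [e]; rfl
    · rintro (_ | ⟨b, _ | ⟨b', r⟩⟩) (_ | ⟨b1, _ | ⟨b1', s⟩⟩) hc hc' hl hl' hne z hz hz'
      · exact absurd rfl hc
      · exact absurd rfl hc
      · exact absurd rfl hc
      · exact absurd rfl hc'
      · refine ⟨[], by simp, ?_⟩
        exact hpp b b1 z (by rintro rfl; exact hne rfl) hz hz'
      · have hz1 : z ∈ (p b).support := hz
        have hz2 : z ∈ Q b1 (b1' :: s) := hz'
        obtain ⟨e1, rfl⟩ := hpA b b1 z hz1 (hQA b1 (b1' :: s) (by simp) (by simpa using hl') hz2)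
        exact ⟨[b], by simp, by rw [e1, ← hg0]⟩
      · exact absurd rfl hc'
      · have hz1 : z ∈ (p b1).support := hz'
        have hz2 : z ∈ Q b (b' :: r) := hz
        obtain ⟨e1, rfl⟩ := hpA b1 b z hz1 (hQA b (b' :: r) (by simp) (by simpa using hl) hz2)
        exact ⟨[b1], by simp, by rw [e1, ← hg0]⟩
      · have hz1 : z ∈ Q b (b' :: r) := hz
        have hz2 : z ∈ Q b1 (b1' :: s) := hz'
        obtain rfl : b = b1 := hA _ _ z (hQA b (b' :: r) (by simp) (by simpa using hl) hz1)
          (hQA b1 (b1' :: s) (by simp) (by simpa using hl') hz2)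
        obtain ⟨t, ht, e⟩ := hQQ b (b' :: r) (b1' :: s) (by simp) (by simp) (by simpa using hl)
          (by simpa using hl') (by rintro e; exact hne (by rw [e])) z hz1 hz2
        exact ⟨b :: t, by simpa using ht, e⟩

theorem BT.subdiv {a n d : ℕ} {v : V} {A : Set V} (h : BT G a n v A) (hd : d ≤ n + 1) :
    HasNSubdivision G (binTree d) a := by
  obtain ⟨g, Q, hg0, hgA, hinj, hpath, hQA, hgQ, hQQ⟩ := h.embed
  let f : {l : List Bool // l.length < d} → V := fun l => g l.1.reverse
  have key : ∀ (l m : {l : List Bool // l.length < d}) (y : Bool), m.1 = y :: l.1 →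
      ∃ p : G.Walk (f l) (f m), p.IsPath ∧ 1 ≤ p.length ∧ p.length ≤ a ∧
        ∀ u ∈ p.support, u ∈ Q m.1.reverse := by
    intro l m y hm
    have hmd := m.2
    obtain ⟨p, hp1, hp2, hp3, hp4⟩ := hpath m.1.reverse (by rw [hm]; simp) (by simp; omega)
    have e : g m.1.reverse.dropLast = f l := by
      simp only [f]; rw [hm]; simp
    refine ⟨p.copy e rfl, ?_, ?_, ?_, ?_⟩
    · simpa using hp1
    · simpa using hp2
    · simpa using hp3
    · intro u hu
      rw [SimpleGraph.Walk.support_copy] at hu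
      exact hp4 u hu
  have key2 : ∀ (l m : {l : List Bool // l.length < d}), (binTree d).Adj l m →
      ∃ (p : G.Walk (f l) (f m)) (c : {l : List Bool // l.length < d}), p.IsPath ∧ 1 ≤ p.length ∧
        p.length ≤ a ∧ (∀ u ∈ p.support, u ∈ Q c.1.reverse) ∧
        ((c = m ∧ ∃ y, m.1 = y :: l.1) ∨ (c = l ∧ ∃ y, l.1 = y :: m.1)) := by
    intro l m hlm
    rw [binTree, SimpleGraph.fromRel_adj] at hlm
    rcases hlm.2 with ⟨y, hy⟩ | ⟨y, hy⟩
    · obtain ⟨p, h1, h2, h3, h4⟩ := key l m y hy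
      exact ⟨p, m, h1, h2, h3, h4, Or.inl ⟨rfl, y, hy⟩⟩
    · obtain ⟨p, h1, h2, h3, h4⟩ := key m l y hy
      refine ⟨p.reverse, l, h1.reverse, by simpa using h2, by simpa using h3, by simpa using h4,
        Or.inr ⟨rfl, y, hy⟩⟩
  choose P C hP1 hP2 hP3 hP4 hC using key2
  have hCne : ∀ l m h, (C l m h).1 ≠ [] := by
    intro l m h
    rcases hC l m h with ⟨e, y, hy⟩ | ⟨e, y, hy⟩ <;> rw [e, hy] <;> simp
  have hCl : ∀ l : {l : List Bool // l.length < d}, l.1.reverse.length ≤ n := by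
    intro l
    have := l.2
    simp; omega
  refine ⟨f, fun l m h => P l m h, ?_, hP1, fun l m h => ⟨hP2 l m h, hP3 l m h⟩, ?_, ?_⟩
  · intro l m hlm
    have := hinj _ _ (hCl l) (hCl m) hlm
    exact Subtype.ext (List.reverse_injective this)
  · rintro l m h z hz ⟨r, rfl⟩
    have hz' := hP4 l m h _ hz
    have hh := hgQ _ _ (by simpa using hCne l m h) (hCl _) (hCl r) hz'
    rcases hC l m h with ⟨e, y, hy⟩ | ⟨e, y, hy⟩
    · rw [e] at hh
      rcases hh with hh | hh
      · right; rw [show r = m from Subtype.ext (List.reverse_injective hh)]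
      · left
        congr 1
        apply Subtype.ext
        apply List.reverse_injective
        rw [hh, hy]; simp
    · rw [e] at hh
      rcases hh with hh | hh
      · left; rw [show r = l from Subtype.ext (List.reverse_injective hh)]
      · right
        congr 1
        apply Subtype.ext
        apply List.reverse_injective
        rw [hh, hy]; simp
  · intro l m l' m' h h' hne z hz hz'
    have hCC : C l m h ≠ C l' m' h' := by
      intro hcc
      apply hne
      rcases hC l m h with ⟨e, y, hy⟩ | ⟨e, y, hy⟩ <;>
        rcases hC l' m' h' with ⟨e', y', hy'⟩ | ⟨e', y', hy'⟩
      · have e1 : m = m' := by rw [← e, ← e', hcc]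
        subst e1
        rw [hy] at hy'
        have : l = l' := Subtype.ext (by simpa using (List.cons.inj hy').2)
        rw [this]
      · have e1 : m = l' := by rw [← e, ← e', hcc]
        subst e1
        rw [hy] at hy'
        have : l = m' := Subtype.ext (by simpa using (List.cons.inj hy').2)
        rw [this, Sym2.eq_swap]
      · have e1 : l = m' := by rw [← e, ← e', hcc]
        subst e1
        rw [hy] at hy'
        have : m = l' := Subtype.ext (by simpa using (List.cons.inj hy').2)
        rw [this, Sym2.eq_swap]
      · have e1 : l = l' := by rw [← e, ← e', hcc]
        subst e1
        rw [hy] at hy'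
        have : m = m' := Subtype.ext (by simpa using (List.cons.inj hy').2)
        rw [this]
    obtain ⟨r, hr, hzr⟩ := hQQ _ _ (by simpa using hCne l m h) (by simpa using hCne l' m' h')
      (hCl _) (hCl _) (fun e => hCC (Subtype.ext (List.reverse_injective e))) z
      (hP4 l m h _ hz) (hP4 l' m' h' _ hz')
    have hz1 := hP4 l m h _ hz
    rw [hzr] at hz1
    rcases hgQ _ _ (by simpa using hCne l m h) (hCl _) hr hz1 with e | e
    · exact ⟨C l m h, by rw [hzr, e]⟩
    · refine ⟨⟨(C l m h).1.tail, ?_⟩, ?_⟩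
      · have := (C l m h).2
        simp; omega
      · rw [hzr, e]; simp [f]
end CM

namespace CM
variable {V : Type*} {G : SimpleGraph V}

theorem path_append_inter {x v y u : V} (q : G.Walk x v) (r : G.Walk v y)
    (h : (q.append r).IsPath) (h1 : u ∈ q.support) (h2 : u ∈ r.support) : u = v := by
  have hn := h.support_nodup
  rw [SimpleGraph.Walk.support_append] at hn
  rw [SimpleGraph.Walk.mem_support_iff] at h2
  rcases h2 with h2 | h2
  · exact h2
  · exact absurd h2 (List.disjoint_of_nodup_append hn h1)

/-- every vertex of `Z` is the root of a binary tree of the right depth -/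
def Cert (G : SimpleGraph V) (a : ℕ) (B Z : Set V) : Prop :=
  ∀ v ∈ Z, ∃ n, (∃ b ∈ B, cnb G Z (n * a) v b) ∧ ∃ A ⊆ Z, BT G a n v A

theorem cert_self (a : ℕ) (B : Set V) : Cert G a B B := by
  intro v hv
  exact ⟨0, ⟨v, hv, SimpleGraph.Walk.nil, by simpa using hv, by simp⟩, {v}, by simpa using hv,
    BT.leaf v⟩

theorem Cert.mono {a : ℕ} {B Z B' : Set V} (h : Cert G a B Z) (hB : B ⊆ B') :
    Cert G a B' (Z ∪ B') := by
  intro v hv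
  by_cases hvZ : v ∈ Z
  · obtain ⟨n, ⟨b, hb, hc⟩, A, hA, hBT⟩ := h v hvZ
    exact ⟨n, ⟨b, hB hb, hc.mono Set.subset_union_left le_rfl⟩, A,
      hA.trans Set.subset_union_left, hBT⟩
  · obtain ⟨n, ⟨b, hb, hc⟩, A, hA, hBT⟩ := cert_self (G := G) a B' v (hv.resolve_left hvZ)
    exact ⟨n, ⟨b, hb, hc.mono Set.subset_union_right le_rfl⟩, A,
      hA.trans Set.subset_union_right, hBT⟩

theorem Cert.near {a d : ℕ} {B Z : Set V} (h : Cert G a B Z)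
    (hno : ¬ HasNSubdivision G (binTree d) a) {v : V} (hv : v ∈ Z) :
    ∃ b ∈ B, cnb G Z (d * a) v b := by
  obtain ⟨n, ⟨b, hb, hc⟩, A, hA, hBT⟩ := h v hv
  refine ⟨b, hb, hc.mono subset_rfl (Nat.mul_le_mul_right _ ?_)⟩
  by_contra hh
  exact hno (hBT.subdiv (by omega))

theorem cert_add {a d δ : ℕ} {B Z : Set V} (h : Cert G a B Z)
    (hno : ¬ HasNSubdivision G (binTree d) a) {x y : V} (hx : x ∈ Z) (hy : y ∈ Z)
    (p : G.Walk x y) (hp : p.IsPath) (hpl : p.length ≤ δ) (hδ : δ ≤ a) (hδ1 : 1 ≤ δ)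
    (hint : ∀ u ∈ p.support, u ∈ Z → u = x ∨ u = y)
    (hfar : ¬ cnb G Z ((2 * d * a + 1) * δ) x y) :
    Cert G a B (Z ∪ {u | u ∈ p.support}) := by
  intro v hv
  by_cases hvZ : v ∈ Z
  · obtain ⟨n, ⟨b, hb, hc⟩, A, hA, hBT⟩ := h v hvZ
    exact ⟨n, ⟨b, hb, hc.mono Set.subset_union_left le_rfl⟩, A,
      hA.trans Set.subset_union_left, hBT⟩
  have hvp : v ∈ p.support := hv.resolve_left hvZ
  obtain ⟨q, r, hl, hq, hr, rfl⟩ := walk_split p hvp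
  have hvx : v ≠ x := by rintro rfl; exact hvZ hx
  have hvy : v ≠ y := by rintro rfl; exact hvZ hy
  have hF3 : ∀ u, u ∈ q.support → u ∈ r.support → u = v :=
    fun u h1 h2 => path_append_inter q r hp h1 h2
  have hF1 : ∀ u, u ∈ q.support → u ∈ Z → u = x := by
    intro u h1 h2
    rcases hint u (hq u h1) h2 with e | e
    · exact e
    · have e2 := hF3 u h1 (by rw [e]; exact r.end_mem_support)
      exact absurd (e2.symm.trans e) hvy
  have hF2 : ∀ u, u ∈ r.support → u ∈ Z → u = y := by
    intro u h1 h2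
    rcases hint u (hr u h1) h2 with e | e
    · have e2 := hF3 u (by rw [e]; exact q.start_mem_support) h1
      exact absurd (e2.symm.trans e) hvx
    · exact e
  obtain ⟨nx, ⟨bx, hbx, hcx⟩, Ax, hAx, hTx⟩ := h x hx
  obtain ⟨ny, ⟨bY, hby, hcy⟩, Ay, hAy, hTy⟩ := h y hy
  obtain ⟨Ax', hAx', hTx'⟩ := hTx.trunc (min nx ny) (min_le_left _ _)
  obtain ⟨Ay', hAy', hTy'⟩ := hTy.trunc (min nx ny) (min_le_right _ _)
  have hmd : min nx ny + 1 < d := by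
    by_contra hh
    exact hno (hTx'.subdiv (by omega))
  have hdis : ∀ u, u ∈ Ax' → u ∉ Ay' := by
    intro u h1 h2
    apply hfar
    have e1 := (hTx'.radius u h1).mono (hAx'.trans hAx) le_rfl
    have e2 := (hTy'.radius u h2).mono (hAy'.trans hAy) le_rfl
    refine (e1.trans e2.symm).mono subset_rfl ?_
    have : min nx ny * a ≤ d * a := Nat.mul_le_mul_right _ (by omega)
    have h3 := Nat.le_mul_of_pos_right (2 * d * a + 1) hδ1
    have h4 : 2 * d * a = 2 * (d * a) := mul_assoc _ _ _
    omega
  have hql : 1 ≤ q.length := by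
    by_contra hh
    exact hvx (SimpleGraph.Walk.eq_of_length_eq_zero (p := q) (by omega)).symm
  have hrl : 1 ≤ r.length := by
    by_contra hh
    exact hvy (SimpleGraph.Walk.eq_of_length_eq_zero (p := r) (by omega))
  have hqp : q.reverse.IsPath := (hp.of_append_left).reverse
  have hrp : r.IsPath := hp.of_append_right
  let xx : Bool → V := fun b => match b with | true => x | false => y
  let AA : Bool → Set V := fun b => match b with | true => Ax' | false => Ay'
  let PP : ∀ b, G.Walk v (xx b) := fun b => match b with | true => q.reverse | false => r
  have hPPt : ∀ u, u ∈ (PP true).support ↔ u ∈ q.support := by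
    intro u
    show u ∈ q.reverse.support ↔ _
    simp
  have hPPf : ∀ u, u ∈ (PP false).support ↔ u ∈ r.support := fun u => Iff.rfl
  have hnode := BT.node (G := G) (a := a) (min nx ny) v xx AA PP
    (by rintro (_ | _); exacts [hTy', hTx'])
    (by
      rintro (_ | _) (_ | _) u h1 h2
      · rfl
      · exact absurd h1 (hdis u h2)
      · exact absurd h2 (hdis u h1)
      · rfl)
    (by rintro (_ | _); exacts [hrp, hqp])
    (by
      rintro (_ | _)
      · exact hrl
      · show 1 ≤ q.reverse.length
        simpa using hql)
    (by
      rintro (_ | _)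
      · show r.length ≤ a
        omega
      · show q.reverse.length ≤ a
        rw [SimpleGraph.Walk.length_reverse]
        omega)
    (by
      rintro (_ | _) (_ | _) u h1 h2
      · exact ⟨hF2 u h1 (hAy (hAy' h2)), rfl⟩
      · have e := hF2 u h1 (hAx (hAx' h2))
        exact absurd (e ▸ hTy'.root_mem) (hdis u h2)
      · have e := hF1 u ((hPPt u).1 h1) (hAy (hAy' h2))
        exact absurd h2 (hdis u (e ▸ hTx'.root_mem))
      · exact ⟨hF1 u ((hPPt u).1 h1) (hAx (hAx' h2)), rfl⟩)
    (by
      rintro (_ | _) (_ | _) u hne h1 h2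
      · exact absurd rfl hne
      · exact hF3 u ((hPPt u).1 h2) h1
      · exact hF3 u ((hPPt u).1 h1) h2
      · exact absurd rfl hne)
  refine ⟨min nx ny + 1, ?_, _, ?_, hnode⟩
  · have hq' : cnb G (Z ∪ {u | u ∈ (q.append r).support}) a v x :=
      ⟨q.reverse, fun u hu => Or.inr (hq u (by simpa using hu)),
        by rw [SimpleGraph.Walk.length_reverse]; omega⟩
    have hr' : cnb G (Z ∪ {u | u ∈ (q.append r).support}) a v y :=
      ⟨r, fun u hu => Or.inr (hr u hu), by omega⟩
    rcases le_total nx ny with hle | hle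
    · rw [min_eq_left hle]
      refine ⟨bx, hbx, (hq'.trans (hcx.mono Set.subset_union_left le_rfl)).mono subset_rfl ?_⟩
      ring_nf; omega
    · rw [min_eq_right hle]
      refine ⟨bY, hby, (hr'.trans (hcy.mono Set.subset_union_left le_rfl)).mono subset_rfl ?_⟩
      ring_nf; omega
  · rintro u ⟨_ | _, hb | hb⟩
    · exact Or.inl (hAy (hAy' hb))
    · exact Or.inr (hr u hb)
    · exact Or.inl (hAx (hAx' hb))
    · exact Or.inr (hq u ((hPPt u).1 hb))

theorem closure_lemma [Finite V] {a d : ℕ} {B Z : Set V} (h : Cert G a B Z)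
    (hno : ¬ HasNSubdivision G (binTree d) a) :
    ∃ Z', Z ⊆ Z' ∧ Cert G a B Z' ∧ ∀ δ ≤ a, ∀ x ∈ Z', ∀ y ∈ Z', nb G δ x y →
      cnb G Z' ((2 * d * a + 1) * δ) x y := by
  obtain ⟨Z', hZ, hmax⟩ := (Set.toFinite {Z' : Set V | Cert G a B Z'}).exists_le_maximal h
  refine ⟨Z', hZ, hmax.1, ?_⟩
  intro δ
  induction δ using Nat.strong_induction_on with
  | _ δ ih =>
  intro hδ x hx y hy hxy
  by_contra hfar
  obtain ⟨w, hw⟩ := hxy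
  classical
  have hpp : w.bypass.IsPath := w.bypass_isPath
  have hpl : w.bypass.length ≤ δ := (w.length_bypass_le_length).trans hw
  generalize w.bypass = p at hpp hpl
  have hδ1 : 1 ≤ δ := by
    by_contra hh
    have : x = y := SimpleGraph.Walk.eq_of_length_eq_zero (p := p) (by omega)
    subst this
    exact hfar ⟨SimpleGraph.Walk.nil, by simpa using hx, by simp⟩
  have hint : ∀ u ∈ p.support, u ∈ Z' → u = x ∨ u = y := by
    intro u hu huZ
    by_contra hne
    push Not at hne
    obtain ⟨q, r, hl, hq, hr, rfl⟩ := walk_split p hu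
    have hql : 1 ≤ q.length := by
      by_contra hh
      exact hne.1 (SimpleGraph.Walk.eq_of_length_eq_zero (p := q) (by omega)).symm
    have hrl : 1 ≤ r.length := by
      by_contra hh
      exact hne.2 (SimpleGraph.Walk.eq_of_length_eq_zero (p := r) (by omega))
    have e1 := ih q.length (by omega) (by omega) x hx u huZ ⟨q, le_rfl⟩
    have e2 := ih r.length (by omega) (by omega) u huZ y hy ⟨r, le_rfl⟩
    refine hfar ((e1.trans e2).mono subset_rfl ?_)
    rw [← Nat.mul_add]
    exact Nat.mul_le_mul_left _ (by omega)
  have hadd := cert_add hmax.1 hno hx hy p hpp hpl hδ hδ1 hint hfar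
  have hsub := hmax.2 hadd (show Z' ≤ _ from Set.subset_union_left)
  apply hfar
  refine ⟨p, fun u hu => hsub (Or.inr hu), ?_⟩
  nlinarith [Nat.zero_le (2 * d * a)]

theorem straight_one {Z : Set V} {x y : V} (h : cn G Z x y) :
    ∃ (n : ℕ) (P : ℕ → V), P 0 = x ∧ P n = y ∧ (∀ p < n, G.Adj (P p) (P (p + 1))) ∧
      (∀ p ≤ n, P p ∈ Z) ∧ ∀ p q m, p ≤ n → q ≤ n → cnb G Z m (P p) (P q) → q ≤ p + m := by
  classical
  have hex : ∃ n, cnb G Z n x y := by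
    obtain ⟨w, hw⟩ := h
    exact ⟨w.length, w, hw, le_rfl⟩
  obtain ⟨w, hw, hl⟩ := Nat.find_spec hex
  have hle : ∀ m, cnb G Z m x y → w.length ≤ m := fun m hm => hl.trans (Nat.find_min' hex hm)
  refine ⟨w.length, w.getVert, by simp, by simp, fun p hp => w.adj_getVert_succ hp,
    fun p hp => hw _ (w.getVert_mem_support p), ?_⟩
  intro p q m hp hq hm
  have e1 : cnb G Z p x (w.getVert p) := ⟨w.take p, fun u hu => hw u
    (SimpleGraph.Walk.isSubwalk_iff_support_isInfix.mp (w.isSubwalk_take _) |>.subset hu), by simp⟩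
  have e2 : cnb G Z (w.length - q) (w.getVert q) y := ⟨w.drop q, fun u hu => hw u
    (SimpleGraph.Walk.isSubwalk_iff_support_isInfix.mp (w.isSubwalk_drop _) |>.subset hu), by simp⟩
  have := hle _ ((e1.trans hm).trans e2)
  omega

theorem straighten [Finite V] {D d K : ℕ} (hno : ¬ HasNSubdivision G (binTree d) D) {S T : Set V}
    (u v : Fin K → V) (w : ∀ i, G.Walk (u i) (v i)) (hu : ∀ i, u i ∈ S) (hv : ∀ i, v i ∈ T)
    (hfar : ∀ i j, i ≠ j → ∀ x ∈ (w i).support, ∀ y ∈ (w j).support,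
      ¬ nb G (D + 2 * (d * D)) x y) :
    ∃ (N : Fin K → ℕ) (P : Fin K → ℕ → V), (∀ i, P i 0 ∈ S) ∧ (∀ i, P i (N i) ∈ T) ∧
      (∀ i, ∀ p < N i, G.Adj (P i p) (P i (p + 1))) ∧
      ∀ i j p q, p ≤ N i → q ≤ N j → nb G D (P i p) (P j q) →
        i = j ∧ p ≤ q + (2 * d * D + 1) * D ∧ q ≤ p + (2 * d * D + 1) * D := by
  choose Z hZ hC hcl using fun i => closure_lemma (cert_self (G := G) D {x | x ∈ (w i).support}) hno
  have hcn : ∀ i, cn G (Z i) (u i) (v i) := fun i => ⟨w i, fun x hx => hZ i hx⟩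
  choose N P hP0 hPN hadj hPZ hst using fun i => straight_one (hcn i)
  refine ⟨N, P, fun i => by rw [hP0]; exact hu i, fun i => by rw [hPN]; exact hv i, hadj, ?_⟩
  intro i j p q hp hq hnb
  have hij : i = j := by
    by_contra hne
    obtain ⟨b, hb, hcb⟩ := (hC i).near hno (hPZ i p hp)
    obtain ⟨b', hb', hcb'⟩ := (hC j).near hno (hPZ j q hq)
    exact hfar i j hne b hb b' hb' (((hcb.nb.symm.trans hnb).trans hcb'.nb).mono (by omega))
  subst hij
  have e := hcl i D le_rfl _ (hPZ i p hp) _ (hPZ i q hq) hnb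
  exact ⟨rfl, hst i q p _ hq hp e.symm, hst i p q _ hp hq e⟩

end CM

namespace CM
variable {V : Type*} {G : SimpleGraph V} {K : ℕ}

/-- data of a family of lines -/
structure Lines (V : Type*) (K : ℕ) where
  N : Fin K → ℕ
  P : Fin K → ℕ → V

/-- consecutive points are adjacent, and points at distance at most `D` are close along a line -/
structure Lines.Good (L : Lines V K) (G : SimpleGraph V) (D h0 : ℕ) : Prop where
  adj : ∀ i, ∀ p < L.N i, G.Adj (L.P i p) (L.P i (p + 1))
  st : ∀ i j p q, p ≤ L.N i → q ≤ L.N j → nb G D (L.P i p) (L.P j q) →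
        i = j ∧ p ≤ q + h0 ∧ q ≤ p + h0

/-- within distance `n` of the lines -/
def nbP (L : Lines V K) (G : SimpleGraph V) (n : ℕ) (w : V) : Prop :=
  ∃ i p, p ≤ L.N i ∧ nb G n w (L.P i p)

/-- distance to the lines -/
noncomputable def dP (L : Lines V K) (G : SimpleGraph V) (w : V) : ℕ := sInf {n | nbP L G n w}

/-- the far region -/
def far (L : Lines V K) (G : SimpleGraph V) (r : ℕ) : Set V := {w | ¬ nbP L G r w}

/-- attachment of a vertex to a line -/
def Att (L : Lines V K) (G : SimpleGraph V) (r : ℕ) (w : V) (i : Fin K) (p : ℕ) : Prop :=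
  p ≤ L.N i ∧ dP L G w ≤ r + 1 ∧ nb G (dP L G w) w (L.P i p)

/-- equal or connected in `Z` -/
def Cn (G : SimpleGraph V) (Z : Set V) (x y : V) : Prop := x = y ∨ cn G Z x y

theorem Cn.trans {Z : Set V} {x y z : V} (h : Cn G Z x y) (h' : Cn G Z y z) : Cn G Z x z := by
  rcases h with rfl | h
  · exact h'
  · rcases h' with rfl | h'
    · exact Or.inr h
    · exact Or.inr (h.trans h')

theorem Cn.symm {Z : Set V} {x y : V} (h : Cn G Z x y) : Cn G Z y x :=
  h.imp Eq.symm cn.symm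

theorem Cn.mono {Z Z' : Set V} {x y : V} (h : Cn G Z x y) (h' : Z ⊆ Z') : Cn G Z' x y :=
  h.imp id (fun h => h.mono h')

theorem nbP.mono {L : Lines V K} {n m : ℕ} {w : V} (h : nbP L G n w) (hm : n ≤ m) : nbP L G m w := by
  obtain ⟨i, p, hp, h⟩ := h
  exact ⟨i, p, hp, h.mono hm⟩

theorem nbP.move {L : Lines V K} {n m : ℕ} {w w' : V} (h : nbP L G n w) (h' : nb G m w' w) :
    nbP L G (m + n) w' := by
  obtain ⟨i, p, hp, h⟩ := h
  exact ⟨i, p, hp, h'.trans h⟩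

theorem dP_le {L : Lines V K} {n : ℕ} {w : V} (h : nbP L G n w) : dP L G w ≤ n := Nat.sInf_le h

theorem exists_att {L : Lines V K} {r : ℕ} {w : V} (h : nbP L G (r + 1) w) :
    ∃ i p, Att L G r w i p := by
  obtain ⟨i, p, hp, hnb⟩ := Nat.sInf_mem (s := {n | nbP L G n w}) ⟨_, h⟩
  exact ⟨i, p, hp, dP_le h, hnb⟩

theorem Att.nb {L : Lines V K} {r : ℕ} {w : V} {i : Fin K} {p : ℕ} (h : Att L G r w i p) :
    nb G (r + 1) w (L.P i p) := h.2.2.mono h.2.1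

theorem line_nb {L : Lines V K} {i : Fin K} (h : ∀ p < L.N i, G.Adj (L.P i p) (L.P i (p + 1)))
    (p m : ℕ) (hm : p + m ≤ L.N i) : nb G m (L.P i p) (L.P i (p + m)) := by
  induction m with
  | zero => exact nb_refl _ _
  | succ m ih => exact (ih (by omega)).trans (nb_adj (h (p + m) (by omega)))

theorem line_nb2 {L : Lines V K} {i : Fin K} (h : ∀ p < L.N i, G.Adj (L.P i p) (L.P i (p + 1)))
    {p q m : ℕ} (hp : p ≤ L.N i) (hq : q ≤ L.N i) (h1 : p ≤ q + m) (h2 : q ≤ p + m) :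
    nb G m (L.P i p) (L.P i q) := by
  rcases le_total p q with hpq | hpq
  · obtain ⟨k, rfl⟩ := Nat.exists_eq_add_of_le hpq
    exact (line_nb h p k hq).mono (by omega)
  · obtain ⟨k, rfl⟩ := Nat.exists_eq_add_of_le hpq
    exact ((line_nb h q k hp).mono (by omega)).symm

/-- reachable attachment points -/
inductive Reach (L : Lines V K) (G : SimpleGraph V) (r Γ : ℕ) (S : Set V) : Fin K → ℕ → Prop
  | src (s w : V) (i : Fin K) (b : ℕ) : s ∈ S → Cn G (far L G r) s w → Att L G r w i b →
      Reach L G r Γ S i b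
  | step (j : Fin K) (q e : ℕ) (w w' : V) (i : Fin K) (b : ℕ) : Reach L G r Γ S j q → e + Γ ≤ q →
      Att L G r w j e → Cn G (far L G r) w w' → Att L G r w' i b → Reach L G r Γ S i b

theorem Reach.le {L : Lines V K} {r Γ : ℕ} {S : Set V} {i : Fin K} {b : ℕ}
    (h : Reach L G r Γ S i b) : b ≤ L.N i := by
  cases h with
  | src s w i b _ _ h => exact h.1
  | step j q e w w' i b _ _ _ _ h => exact h.1

/-- a vertex from which we can go on -/
def goodv (L : Lines V K) (G : SimpleGraph V) (r Γ : ℕ) (S : Set V) (v : V) : Prop :=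
  (∃ s ∈ S, cn G (far L G r) s v) ∨
  (∃ j q e x, Reach L G r Γ S j q ∧ e + Γ ≤ q ∧ Att L G r x j e ∧ Cn G (far L G r) x v)

theorem separation {L : Lines V K} {r Γ D h0 : ℕ} {S T : Set V} (hL : L.Good G D h0)
    (hD : 2 * r + 3 ≤ D) (hT : ∀ t ∈ T, ¬ goodv L G r Γ S t) :
    ∃ X : Finset V, X.card ≤ K ∧ ∀ (s t : V) (w : G.Walk s t), s ∈ S → t ∈ T →
      ∃ y ∈ w.support, ∃ x ∈ X, nb G (r + 1 + Γ + h0) y x := by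
  classical
  have hx : ∀ i, ∃ x, x ≤ L.N i ∧ ∀ b, Reach L G r Γ S i b → b ≤ x ∧ Reach L G r Γ S i x := by
    intro i
    by_cases hb : ∃ b, Reach L G r Γ S i b
    · obtain ⟨b, hb⟩ := hb
      refine ⟨Nat.findGreatest (Reach L G r Γ S i) (L.N i), Nat.findGreatest_le _, fun b' hb' =>
        ⟨Nat.le_findGreatest hb'.le hb', Nat.findGreatest_spec hb'.le hb'⟩⟩
    · exact ⟨0, Nat.zero_le _, fun b' hb' => absurd ⟨b', hb'⟩ hb⟩
  choose x hxN hx using hx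
  refine ⟨Finset.univ.image (fun i => L.P i (x i)), ?_, ?_⟩
  · exact Finset.card_image_le.trans (by simp)
  have near : ∀ v i p q, Att L G r v i p → Reach L G r Γ S i q → p ≤ q + h0 →
      ¬ (∃ q', Reach L G r Γ S i q' ∧ p + Γ ≤ q') →
      ∃ x' ∈ Finset.univ.image (fun i => L.P i (x i)), nb G (r + 1 + Γ + h0) v x' := by
    intro v i p q ha hr hpq hav
    refine ⟨L.P i (x i), by simp, ?_⟩
    obtain ⟨h1, h2⟩ := hx i q hr
    have h3 : ¬ (p + Γ ≤ x i) := fun h => hav ⟨_, h2, h⟩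
    have := ha.nb.trans (line_nb2 (hL.adj i) ha.1 (hxN i) (m := Γ + h0) (by omega) (by omega))
    exact this.mono (by omega)
  have key : ∀ (u t : V) (w : G.Walk u t), t ∈ T → goodv L G r Γ S u →
      ∃ y ∈ w.support, ∃ x' ∈ Finset.univ.image (fun i => L.P i (x i)),
        nb G (r + 1 + Γ + h0) y x' := by
    intro u t w ht
    induction w with
    | nil => exact fun h => absurd h (hT _ ht)
    | @cons u v t huv w ih =>
      intro hg
      by_cases hv : goodv L G r Γ S v
      · obtain ⟨y, hy, h⟩ := ih ht hv
        exact ⟨y, by simp [hy], h⟩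
      · refine ⟨v, by simp, ?_⟩
        have hnot : nbP L G (r + 1) u ∧ nbP L G (r + 1) v := by
          by_contra hh
          apply hv
          have hu' : u ∈ far L G r := by
            intro h
            exact hh ⟨h.mono (by omega), (h.move (nb_adj huv.symm)).mono (by omega)⟩
          have hv' : v ∈ far L G r := by
            intro h
            exact hh ⟨(h.move (nb_adj huv)).mono (by omega), h.mono (by omega)⟩
          have hc := cn_adj huv hu' hv'
          rcases hg with ⟨s, hs, h⟩ | ⟨j, q, e, x, h1, h2, h3, h4⟩
          · exact Or.inl ⟨s, hs, h.trans hc⟩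
          · exact Or.inr ⟨j, q, e, x, h1, h2, h3, h4.trans (Or.inr hc)⟩
        obtain ⟨i, p, hi⟩ := exists_att hnot.1
        obtain ⟨i', p', hi'⟩ := exists_att hnot.2
        have hr : Reach L G r Γ S i p := by
          rcases hg with ⟨s, hs, h⟩ | ⟨j, q, e, x, h1, h2, h3, h4⟩
          · exact Reach.src s u i p hs (Or.inr h) hi
          · exact Reach.step j q e x u i p h1 h2 h3 h4 hi
        obtain ⟨e1, e2, e3⟩ := hL.st i i' p p' hi.1 hi'.1
          (((hi.nb.symm.trans (nb_adj huv)).trans hi'.nb).mono (by omega))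
        subst e1
        refine near v i p' p hi' hr e3 ?_
        rintro ⟨q', hq', hle⟩
        exact hv (Or.inr ⟨i, q', p', v, hq', hle, hi', Or.inl rfl⟩)
  intro s t w hs ht
  by_cases hg : goodv L G r Γ S s
  · exact key s t w ht hg
  · refine ⟨s, by simp, ?_⟩
    have hsf : nbP L G (r + 1) s := by
      by_contra hh
      exact hg (Or.inl ⟨s, hs, cn_refl (fun h => hh (h.mono (by omega)))⟩)
    obtain ⟨i, p, hi⟩ := exists_att hsf
    have hr : Reach L G r Γ S i p := Reach.src s s i p hs (Or.inl rfl) hi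
    refine near s i p p hi hr (by omega) ?_
    rintro ⟨q', hq', hle⟩
    exact hg (Or.inr ⟨i, q', p, s, hq', hle, hi, Or.inl rfl⟩)

/-- a visit of a route to a line -/
structure Vis (V : Type*) (K : ℕ) where
  i : Fin K
  b : ℕ
  e : ℕ
  wb : V
  we : V

/-- the list of visits links `x0` to `xf` -/
def Chain (R : V → V → Prop) : V → List (Vis V K) → V → Prop
  | x0, [], xf => R x0 xf
  | x0, v :: l, xf => R x0 v.wb ∧ Chain R v.we l xf

theorem chain_append {R : V → V → Prop} (l1 : List (Vis V K)) (v : Vis V K) (l2 : List (Vis V K))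
    (x y : V) : Chain R x (l1 ++ v :: l2) y ↔ Chain R x l1 v.wb ∧ Chain R v.we l2 y := by
  induction l1 generalizing x with
  | nil => simp [Chain]
  | cons u l ih => simp [Chain, ih, and_assoc]

theorem list_last {α : Type*} (p : α → Prop) (l : List α) (h : ∃ y ∈ l, p y) :
    ∃ l1 y l2, l = l1 ++ y :: l2 ∧ p y ∧ ∀ u ∈ l2, ¬ p u := by
  induction l with
  | nil => simp at h
  | cons a l ih =>
    by_cases h' : ∃ y ∈ l, p y
    · obtain ⟨l1, y, l2, rfl, h1, h2⟩ := ih h'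
      exact ⟨a :: l1, y, l2, rfl, h1, h2⟩
    · refine ⟨[], a, l, rfl, ?_, fun u hu hp => h' ⟨u, hu, hp⟩⟩
      obtain ⟨y, hy, hp⟩ := h
      rcases List.mem_cons.1 hy with rfl | hy
      · exact hp
      · exact absurd ⟨y, hy, hp⟩ h'

theorem list_not_pairwise {α : Type*} (R : α → α → Prop) (l : List α) (h : ¬ l.Pairwise R) :
    ∃ l1 x l2 y l3, l = l1 ++ x :: (l2 ++ y :: l3) ∧ ¬ R x y := by
  induction l with
  | nil => simp at h
  | cons a l ih =>
    by_cases h' : l.Pairwise R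
    · rw [List.pairwise_cons] at h
      have : ∃ y ∈ l, ¬ R a y := by
        by_contra hh
        push Not at hh
        exact h ⟨hh, h'⟩
      obtain ⟨y, hy, hn⟩ := this
      obtain ⟨l2, l3, rfl⟩ := List.append_of_mem hy
      exact ⟨[], a, l2, y, l3, rfl, hn⟩
    · obtain ⟨l1, x, l2, y, l3, rfl, hn⟩ := ih h'
      exact ⟨a :: l1, x, l2, y, l3, rfl, hn⟩

/-- both ends of the visit attach -/
def Vis.Ok (L : Lines V K) (G : SimpleGraph V) (r : ℕ) (v : Vis V K) : Prop :=
  Att L G r v.wb v.i v.b ∧ Att L G r v.we v.i v.e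

theorem claimA {R : V → V → Prop} {L : Lines V K} {r Γ g : ℕ} (hg : g ≤ Γ) (n : ℕ) :
    ∀ (l : List (Vis V K)) (x0 xf : V), l.length ≤ n → Chain R x0 l xf → (∀ v ∈ l, v.Ok L G r) →
      (∀ v ∈ l, v.e + Γ ≤ v.b) →
      ∃ l' : List (Vis V K), Chain R x0 l' xf ∧ (l ≠ [] → l' ≠ []) ∧ (∀ v ∈ l', v.Ok L G r) ∧
        (∀ v ∈ l', v.e + g ≤ v.b) ∧ (∀ v ∈ l', ∃ u ∈ l, u.i = v.i ∧ u.e = v.e) ∧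
        (∀ v ∈ l', ∃ u ∈ l, u.i = v.i ∧ u.b = v.b) ∧
        l'.Pairwise (fun t u => t.i = u.i → t.b < u.e + g ∧ t.b + Γ ≤ u.b + g) := by
  induction n with
  | zero =>
    intro l x0 xf hl hc _ _
    obtain rfl : l = [] := List.eq_nil_of_length_eq_zero (by omega)
    exact ⟨[], hc, by simp, by simp, by simp, by simp, by simp, by simp⟩
  | succ n ih =>
    intro l x0 xf hl hc hok hgap
    rcases l with _ | ⟨v, m⟩
    · exact ⟨[], hc, by simp, by simp, by simp, by simp, by simp, by simp⟩
    have hv := hgap v (by simp)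
    obtain ⟨l1, y, l2, hsp, ⟨hy1, hy2⟩, hlast⟩ := list_last (fun y => y.i = v.i ∧ y.e + g ≤ v.b)
      (v :: m) ⟨v, by simp, rfl, by omega⟩
    have hc0 : R x0 v.wb := hc.1
    have hlen : (v :: m).length = (l1 ++ y :: l2).length := by rw [hsp]
    rw [hsp] at hc
    have hyl : y ∈ v :: m := by rw [hsp]; simp
    have hsub : ∀ u ∈ l2, u ∈ v :: m := by
      intro u hu
      rw [hsp]; simp [hu]
    obtain ⟨l', h1, h2, h3, h4, h5, h6, h7⟩ := ih l2 y.we xf (by simp at hlen hl; omega)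
      ((chain_append _ _ _ _ _).1 hc).2 (fun u hu => hok u (hsub u hu))
      (fun u hu => hgap u (hsub u hu))
    refine ⟨⟨v.i, v.b, y.e, v.wb, y.we⟩ :: l', ⟨hc0, h1⟩, by simp, ?_, ?_, ?_, ?_, ?_⟩
    · intro u hu
      rcases List.mem_cons.1 hu with rfl | hu
      · refine ⟨(hok v (by simp)).1, ?_⟩
        have := (hok y hyl).2
        rw [hy1] at this
        exact this
      · exact h3 u hu
    · intro u hu
      rcases List.mem_cons.1 hu with rfl | hu
      · exact hy2
      · exact h4 u hu
    · intro u hu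
      rcases List.mem_cons.1 hu with rfl | hu
      · exact ⟨y, hyl, hy1, rfl⟩
      · obtain ⟨z, hz, h⟩ := h5 u hu
        exact ⟨z, hsub z hz, h⟩
    · intro u hu
      rcases List.mem_cons.1 hu with rfl | hu
      · exact ⟨v, by simp, rfl, rfl⟩
      · obtain ⟨z, hz, h⟩ := h6 u hu
        exact ⟨z, hsub z hz, h⟩
    · rw [List.pairwise_cons]
      refine ⟨?_, h7⟩
      intro u hu hi
      simp only at hi ⊢
      obtain ⟨z, hz, hzi, hze⟩ := h5 u hu
      obtain ⟨z', hz', hzi', hzb'⟩ := h6 u hu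
      have e1 := hlast z hz
      have e2 := hlast z' hz'
      have e3 := hgap z' (hsub z' hz')
      have e4 : ¬ (z.e + g ≤ v.b) := fun h => e1 ⟨hzi.trans hi.symm, h⟩
      have e5 : ¬ (z'.e + g ≤ v.b) := fun h => e2 ⟨hzi'.trans hi.symm, h⟩
      omega

/-- the pairwise relation used in the merging step -/
def Qrel (g h Γ : ℕ) (t u : Vis V K) : Prop :=
  t.i = u.i → t.b < u.e + g ∧ t.b + Γ ≤ u.b + g ∧ (t.e + g ≤ t.b ∨ t.b + h ≤ u.e)

theorem claimB {R : V → V → Prop} {L : Lines V K} {r Γ g h : ℕ} (hg : g = 2 * h) (hΓ : Γ = 3 * g)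
    (n : ℕ) : ∀ (l : List (Vis V K)) (x0 xf : V), l.length ≤ n → Chain R x0 l xf →
      (∀ v ∈ l, v.Ok L G r) → l ≠ [] → (∀ v ∈ l, v.e + g ≤ v.b + h) → l.Pairwise (Qrel g h Γ) →
      ∃ l' : List (Vis V K), Chain R x0 l' xf ∧ l' ≠ [] ∧ (∀ v ∈ l', v.Ok L G r) ∧
        (∀ v ∈ l', v.e + g ≤ v.b + h) ∧ l'.Pairwise (Qrel g h Γ) ∧
        l'.Pairwise (fun t u => t.i = u.i → t.e + h ≤ u.e) := by
  induction n with
  | zero =>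
    intro l x0 xf hl _ _ hne
    exact absurd (List.eq_nil_of_length_eq_zero (by omega)) hne
  | succ n ih =>
    intro l x0 xf hl hc hok hne hgap hpw
    by_cases hfin : l.Pairwise (fun t u => t.i = u.i → t.e + h ≤ u.e)
    · exact ⟨l, hc, hne, hok, hgap, hpw, hfin⟩
    obtain ⟨l1, x, l2, y, l3, rfl, hxy⟩ := list_not_pairwise _ _ hfin
    push Not at hxy
    obtain ⟨hi, hlt⟩ := hxy
    rw [chain_append, chain_append] at hc
    have hpw' := hpw
    rw [List.pairwise_append] at hpw
    obtain ⟨p1, p2, p3⟩ := hpw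
    rw [List.pairwise_cons] at p2
    obtain ⟨p4, p5⟩ := p2
    rw [List.pairwise_append] at p5
    obtain ⟨p6, p7, p8⟩ := p5
    rw [List.pairwise_cons] at p7
    obtain ⟨p9, p10⟩ := p7
    have hQxy := p4 y (by simp) hi
    have hxgap := hgap x (by simp)
    apply ih (l1 ++ ⟨x.i, x.b, y.e, x.wb, y.we⟩ :: l3) x0 xf
    · simp at hl ⊢; omega
    · rw [chain_append]
      exact ⟨hc.1, hc.2.2⟩
    · intro v hv
      simp only [List.mem_append, List.mem_cons] at hv
      rcases hv with hv | rfl | hv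
      · exact hok v (by simp [hv])
      · refine ⟨(hok x (by simp)).1, ?_⟩
        have := (hok y (by simp)).2
        rw [← hi] at this
        exact this
      · exact hok v (by simp [hv])
    · simp
    · intro v hv
      simp only [List.mem_append, List.mem_cons] at hv
      rcases hv with hv | rfl | hv
      · exact hgap v (by simp [hv])
      · simp only
        omega
      · exact hgap v (by simp [hv])
    · rw [List.pairwise_append, List.pairwise_cons]
      refine ⟨p1, ⟨?_, p10⟩, ?_⟩
      · intro u hu hiu
        simp only at hiu ⊢
        have q1 := p4 u (by simp [hu]) hiu
        have q2 := p9 u hu (hi.symm.trans hiu)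
        omega
      · intro t ht u hu
        rcases List.mem_cons.1 hu with rfl | hu
        · intro hit
          simp only at hit ⊢
          have q1 := p3 t ht x (by simp) hit
          have q2 := p3 t ht y (by simp) (hit.trans hi)
          omega
        · exact p3 t ht u (by simp [hu])

theorem Reach.list {L : Lines V K} {r Γ : ℕ} {S : Set V} {i : Fin K} {b : ℕ}
    (h : Reach L G r Γ S i b) : ∃ s ∈ S, ∃ w, Att L G r w i b ∧ ∃ l : List (Vis V K),
      (∀ v ∈ l, v.Ok L G r) ∧ (∀ v ∈ l, v.e + Γ ≤ v.b) ∧ Chain (Cn G (far L G r)) s l w := by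
  induction h with
  | src s w i b hs hc ha => exact ⟨s, hs, w, ha, [], by simp, by simp, hc⟩
  | step j q e w w' i b hr hle ha hc ha' ih =>
    obtain ⟨s, hs, w0, hw0, l, h1, h2, h3⟩ := ih
    refine ⟨s, hs, w', ha', l ++ [⟨j, q, e, w0, w⟩], ?_, ?_, ?_⟩
    · intro v hv
      simp only [List.mem_append, List.mem_singleton] at hv
      rcases hv with hv | rfl
      · exact h1 v hv
      · exact ⟨hw0, ha⟩
    · intro v hv
      simp only [List.mem_append, List.mem_singleton] at hv
      rcases hv with hv | rfl
      · exact h2 v hv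
      · exact hle
    · rw [chain_append]
      exact ⟨h3, hc⟩

/-- start of the `k`-th jump -/
def al (s : V) (v : ℕ → Vis V K) : ℕ → V
  | 0 => s
  | k + 1 => (v k).we

/-- end of the `k`-th jump -/
def om (t : V) (n : ℕ) (v : ℕ → Vis V K) (k : ℕ) : V := if k < n then (v k).wb else t

/-- index form of the separation conditions -/
structure Star (h : ℕ) (n : ℕ) (v : ℕ → Vis V K) : Prop where
  s1 : ∀ k < n, (v k).e + h ≤ (v k).b
  s2 : ∀ j k, j < k → k < n → (v j).i = (v k).i → (v j).e + h ≤ (v k).e ∧ (v j).b + h ≤ (v k).b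
  s3 : ∀ j k m, j < k → k < m → m < n → (v j).i = (v k).i → (v k).i = (v m).i →
    (v j).b + h ≤ (v m).e

theorem chain_index {R : V → V → Prop} (d : Vis V K) (l : List (Vis V K)) (s t : V)
    (h : Chain R s l t) : ∀ k ≤ l.length,
      R (al s (fun k => l.getD k d) k) (om t l.length (fun k => l.getD k d) k) := by
  induction l generalizing s with
  | nil =>
    intro k hk
    obtain rfl : k = 0 := by simpa using hk
    simpa [al, om, Chain] using h
  | cons v l ih =>
    intro k hk
    rcases k with _ | k
    · simpa [al, om] using h.1
    · have := ih v.we h.2 k (by simpa using hk)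
      rcases k with _ | k
      · simpa [al, om] using this
      · simpa [al, om] using this

theorem selection [NeZero K] {L : Lines V K} {r Γ g h : ℕ} {S T : Set V} (hg : g = 2 * h)
    (hΓ : Γ = 3 * g) (hT : ∃ t ∈ T, goodv L G r Γ S t) :
    ∃ s ∈ S, ∃ t ∈ T, ∃ (n : ℕ) (v : ℕ → Vis V K), (∀ k < n, (v k).Ok L G r) ∧
      (∀ k ≤ n, Cn G (far L G r) (al s v k) (om t n v k)) ∧ Star h n v ∧
      (n = 0 → cn G (far L G r) s t) := by
  obtain ⟨t, ht, ⟨s, hs, hc⟩ | ⟨j, q, e, x, hr, hle, ha, hc⟩⟩ := hT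
  · refine ⟨s, hs, t, ht, 0, fun _ => ⟨0, 0, 0, s, s⟩, by simp, ?_, ⟨by simp, by simp, by simp⟩,
      fun _ => hc⟩
    intro k hk
    obtain rfl : k = 0 := by omega
    exact Or.inr hc
  · obtain ⟨s, hs, w, hw, l0, h1, h2, h3⟩ := hr.list
    obtain ⟨l1, a1, a2, a3, a4, -, -, a7⟩ := claimA (R := Cn G (far L G r)) (L := L) (G := G)
      (r := r) (Γ := Γ) (g := g) (by omega) _ (l0 ++ [⟨j, q, e, w, x⟩]) s t le_rfl
      ((chain_append l0 ⟨j, q, e, w, x⟩ [] s t).2 ⟨h3, hc⟩)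
      (by
        intro v hv
        simp only [List.mem_append, List.mem_singleton] at hv
        rcases hv with hv | rfl
        · exact h1 v hv
        · exact ⟨hw, ha⟩)
      (by
        intro v hv
        simp only [List.mem_append, List.mem_singleton] at hv
        rcases hv with hv | rfl
        · exact h2 v hv
        · exact hle)
    obtain ⟨l, b1, b2, b3, b4, b5, b6⟩ := claimB (R := Cn G (far L G r)) (L := L) (G := G)
      (r := r) hg hΓ _ l1 s t le_rfl a1 a3 (a2 (by simp))
      (fun v hv => by have := a4 v hv; omega)
      (by
        refine List.Pairwise.imp_of_mem ?_ a7
        intro t u ht hu htu hi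
        exact ⟨(htu hi).1, (htu hi).2, Or.inl (a4 t ht)⟩)
    let dd : Vis V K := ⟨j, q, e, w, x⟩
    have hget : ∀ k (hk : k < l.length), l.getD k dd = l[k] := fun k hk => by simp [hk]
    have hQ : ∀ i k, i < k → k < l.length → Qrel g h Γ (l.getD i dd) (l.getD k dd) := by
      intro i k hik hk
      rw [hget i (by omega), hget k hk]
      exact List.pairwise_iff_getElem.1 b5 i k _ _ hik
    have hE : ∀ i k, i < k → k < l.length → (l.getD i dd).i = (l.getD k dd).i →
        (l.getD i dd).e + h ≤ (l.getD k dd).e := by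
      intro i k hik hk
      rw [hget i (by omega), hget k hk]
      exact List.pairwise_iff_getElem.1 b6 i k _ _ hik
    refine ⟨s, hs, t, ht, l.length, fun k => l.getD k dd, ?_, chain_index dd l s t b1, ?_, ?_⟩
    · intro k hk
      beta_reduce
      rw [hget k hk]
      exact b3 _ (List.getElem_mem _)
    · constructor
      · intro k hk
        have := b4 (l.getD k dd) (by rw [hget k hk]; exact List.getElem_mem _)
        omega
      · intro i k hik hk hi
        refine ⟨hE i k hik hk hi, ?_⟩
        have := hQ i k hik hk hi
        omega
      · intro i k m hik hkm hm hi hi'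
        have e1 := hQ i k hik (by omega) hi
        have e2 := hQ k m hkm hm hi'
        omega
    · intro h0
      exact absurd (List.eq_nil_of_length_eq_zero h0) b2

end CM

namespace CM
variable {V : Type*} {G : SimpleGraph V} {K : ℕ}

/-- position of an end of a visit (`true` for the landing) -/
def Vis.pos (v : Vis V K) (β : Bool) : ℕ := if β then v.b else v.e

/-- top vertex of an end of a visit -/
def Vis.top (v : Vis V K) (β : Bool) : V := if β then v.wb else v.we

theorem Vis.Ok.att {L : Lines V K} {r : ℕ} {v : Vis V K} (h : v.Ok L G r) (β : Bool) :
    Att L G r (v.top β) v.i (v.pos β) := by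
  cases β
  · exact h.2
  · exact h.1

/-- vertices on a shortest connection from `w` to a line point -/
def Stub (L : Lines V K) (G : SimpleGraph V) (w : V) (i : Fin K) (p : ℕ) (x : V) : Prop :=
  ∃ k l, k + l = dP L G w ∧ nb G k w x ∧ nb G l x (L.P i p)

theorem Stub.nb {L : Lines V K} {r : ℕ} {w x : V} {i : Fin K} {p : ℕ} (h : Stub L G w i p x)
    (ha : Att L G r w i p) : nb G (r + 1) x (L.P i p) := by
  obtain ⟨k, l, hkl, h1, h2⟩ := h
  have := ha.2.1
  exact h2.mono (by omega)

theorem stub_top {L : Lines V K} {r : ℕ} {w : V} {i : Fin K} {p : ℕ} (ha : Att L G r w i p) :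
    Stub L G w i p w := ⟨0, _, by simp, nb_refl _ _, ha.2.2⟩

theorem stub_walk {L : Lines V K} {r : ℕ} {w : V} {i : Fin K} {p : ℕ} (ha : Att L G r w i p) :
    cn G {x | Stub L G w i p x} w (L.P i p) := by
  obtain ⟨q, hq⟩ := ha.2.2
  refine ⟨q, fun u hu => ?_⟩
  obtain ⟨q1, q2, hl, -, -, -⟩ := walk_split q hu
  exact ⟨q1.length, dP L G w - q1.length, by omega, ⟨q1, le_rfl⟩, ⟨q2, by omega⟩⟩

theorem stub_conn {L : Lines V K} {ρ : ℕ} {w x : V} {i : Fin K} {p : ℕ} (hp : p ≤ L.N i)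
    (h : Stub L G w i p x) (hx : ¬ nbP L G ρ x) :
    cn G {y | Stub L G w i p y ∧ ¬ nbP L G ρ y} w x := by
  obtain ⟨k, l, hkl, ⟨q, hq⟩, h2⟩ := h
  refine ⟨q, fun u hu => ?_⟩
  obtain ⟨q1, q2, hl, -, -, -⟩ := walk_split q hu
  refine ⟨⟨k - q2.length, q2.length + l, by omega, ⟨q1, by omega⟩, nb.trans ⟨q2, le_rfl⟩ h2⟩, ?_⟩
  intro hu'
  have h3 := dP_le (hu'.move ⟨q1, le_rfl⟩)
  exact hx ⟨i, p, hp, h2.mono (by omega)⟩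

/-- two ends at the same place -/
def SP (h0 : ℕ) (v v' : Vis V K) (β β' : Bool) : Prop :=
  v.i = v'.i ∧ v.pos β ≤ v'.pos β' + h0 ∧ v'.pos β' ≤ v.pos β + h0

/-- the base set -/
def Bset (L : Lines V K) (G : SimpleGraph V) (r ρ0 ρ1 h0 n0 : ℕ) (v0 : ℕ → Vis V K)
    (κ : ℕ → Prop) : Set V :=
  {x | ¬ nbP L G r x ∨ ∃ k < n0, ∃ β, Stub L G ((v0 k).top β) (v0 k).i ((v0 k).pos β) x ∧
    (¬ nbP L G ρ0 x ∨ (¬ nbP L G ρ1 x ∧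
      ∀ k' β', κ k' → SP h0 (v0 k') (v0 k) β' β → k' = k ∧ β' = β))}

theorem Bset_anti {L : Lines V K} {r ρ0 ρ1 h0 n0 : ℕ} {v0 : ℕ → Vis V K} {κ κ' : ℕ → Prop}
    (h : ∀ k, κ' k → κ k) : Bset L G r ρ0 ρ1 h0 n0 v0 κ ⊆ Bset L G r ρ0 ρ1 h0 n0 v0 κ' := by
  rintro x (hx | ⟨k, hk, β, hs, hx | ⟨hx, hx'⟩⟩)
  · exact Or.inl hx
  · exact Or.inr ⟨k, hk, β, hs, Or.inl hx⟩
  · exact Or.inr ⟨k, hk, β, hs, Or.inr ⟨hx, fun k' β' h1 h2 => hx' k' β' (h k' h1) h2⟩⟩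

theorem Bset_far {L : Lines V K} {r ρ0 ρ1 h0 n0 : ℕ} {v0 : ℕ → Vis V K} {κ : ℕ → Prop} {x : V}
    (h1 : ρ1 ≤ ρ0) (h2 : ρ0 ≤ r) (hx : x ∈ Bset L G r ρ0 ρ1 h0 n0 v0 κ) : ¬ nbP L G ρ1 x := by
  intro hn
  rcases hx with hx | ⟨k, hk, β, hs, hx | ⟨hx, hx'⟩⟩
  · exact hx (hn.mono (h1.trans h2))
  · exact hx (hn.mono h1)
  · exact hx hn

/-- valid subsequences -/
structure Valid (L : Lines V K) (G : SimpleGraph V) (r ρ0 ρ1 h0 n0 a : ℕ) (v0 : ℕ → Vis V K)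
    (s t : V) (n : ℕ) (f : ℕ → ℕ) (Z : Set V) : Prop where
  mono : ∀ j k, j < k → k < n → f j < f k
  lt : ∀ k < n, f k < n0
  sub : Bset L G r ρ0 ρ1 h0 n0 v0 (fun k => ∃ j < n, f j = k) ⊆ Z
  cert : Cert G a (Bset L G r ρ0 ρ1 h0 n0 v0 (fun k => ∃ j < n, f j = k)) Z
  link : ∀ k ≤ n, Cn G Z (al s (fun k => v0 (f k)) k) (om t n (fun k => v0 (f k)) k)
  zero : n = 0 → cn G Z s t

theorem exists_minimal [Finite V] {L : Lines V K} {r ρ0 ρ1 h0 n0 a d : ℕ} {v0 : ℕ → Vis V K}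
    {s t : V} (hno : ¬ HasNSubdivision G (binTree d) a)
    (hlink : ∀ k ≤ n0, Cn G (far L G r) (al s v0 k) (om t n0 v0 k))
    (hzero : n0 = 0 → cn G (far L G r) s t) :
    ∃ n f Z, Valid L G r ρ0 ρ1 h0 n0 a v0 s t n f Z ∧
      (∀ x ∈ Z, ∀ y ∈ Z, nb G a x y → cn G Z x y) ∧
      (∀ p q, p < q → q ≤ n → ¬ cn G Z (al s (fun k => v0 (f k)) p)
        (om t n (fun k => v0 (f k)) q)) := by
  classical
  have hex : ∃ n f Z, Valid L G r ρ0 ρ1 h0 n0 a v0 s t n f Z := by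
    have hsub : far L G r ⊆ Bset L G r ρ0 ρ1 h0 n0 v0 (fun k => ∃ j < n0, id j = k) :=
      fun x hx => Or.inl hx
    refine ⟨n0, id, Bset L G r ρ0 ρ1 h0 n0 v0 (fun k => ∃ j < n0, id j = k), fun j k h _ => h,
      fun k h => h, subset_rfl, cert_self _ _, ?_, fun h => (hzero h).mono hsub⟩
    exact fun k hk => (hlink k hk).mono hsub
  obtain ⟨f, Z0, hV⟩ := Nat.find_spec hex
  have hmin : ∀ m f Z, Valid L G r ρ0 ρ1 h0 n0 a v0 s t m f Z → Nat.find hex ≤ m :=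
    fun m f Z h => Nat.find_min' hex ⟨f, Z, h⟩
  generalize Nat.find hex = n at hV hmin
  obtain ⟨Z, hZ, hC, hcl⟩ := closure_lemma hV.cert hno
  refine ⟨n, f, Z, ⟨hV.mono, hV.lt, hV.sub.trans hZ, hC, fun k hk => (hV.link k hk).mono hZ,
    fun h => (hV.zero h).mono hZ⟩, fun x hx y hy h => (hcl a le_rfl x hx y hy h).cn, ?_⟩
  intro p q hpq hqn hcn
  let f' : ℕ → ℕ := fun k => if k < p then f k else f (k + (q - p))
  have hf1 : ∀ k, k < p → f' k = f k := fun k hk => by simp [f', hk]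
  have hf2 : ∀ k, p ≤ k → f' k = f (k + (q - p)) := fun k hk => by simp [f', Nat.not_lt.2 hk]
  have hB := Bset_anti (L := L) (G := G) (r := r) (ρ0 := ρ0) (ρ1 := ρ1) (h0 := h0) (n0 := n0)
    (v0 := v0) (κ := fun k => ∃ j < n, f j = k) (κ' := fun k => ∃ j < n - (q - p), f' j = k) (by
      rintro k ⟨j, hj, rfl⟩
      by_cases hjp : j < p
      · exact ⟨j, by omega, (hf1 j hjp).symm⟩
      · exact ⟨j + (q - p), by omega, (hf2 j (by omega)).symm⟩)
  have := hmin (n - (q - p)) f' (Z ∪ Bset L G r ρ0 ρ1 h0 n0 v0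
    (fun k => ∃ j < n - (q - p), f' j = k)) ⟨?_, ?_, Set.subset_union_right, hC.mono hB, ?_, ?_⟩
  · omega
  · intro j k hjk hk
    by_cases hkp : k < p
    · rw [hf1 j (by omega), hf1 k hkp]
      exact hV.mono j k hjk (by omega)
    · rw [hf2 k (by omega)]
      by_cases hjp : j < p
      · rw [hf1 j hjp]
        exact hV.mono _ _ (by omega) (by omega)
      · rw [hf2 j (by omega)]
        exact hV.mono _ _ (by omega) (by omega)
  · intro k hk
    by_cases hkp : k < p
    · rw [hf1 k hkp]
      exact hV.lt _ (by omega)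
    · rw [hf2 k (by omega)]
      exact hV.lt _ (by omega)
  · intro k hk
    refine Cn.mono ?_ Set.subset_union_left
    have hal1 : ∀ k ≤ p, al s (fun k => v0 (f' k)) k = al s (fun k => v0 (f k)) k := by
      intro k hk
      rcases k with _ | k
      · rfl
      · simp only [al]
        rw [hf1 k (by omega)]
    have hal2 : ∀ k, p < k → al s (fun k => v0 (f' k)) k = al s (fun k => v0 (f k)) (k + (q - p)) := by
      intro k hk
      rcases k with _ | k
      · omega
      · rw [show k + 1 + (q - p) = (k + (q - p)) + 1 by omega]
        simp only [al]
        rw [hf2 k (by omega)]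
    have hom1 : ∀ k < p, om t (n - (q - p)) (fun k => v0 (f' k)) k = om t n (fun k => v0 (f k)) k := by
      intro k hk
      simp only [om]
      rw [if_pos (by omega), if_pos (by omega), hf1 k hk]
    have hom2 : ∀ k, p ≤ k → om t (n - (q - p)) (fun k => v0 (f' k)) k =
        om t n (fun k => v0 (f k)) (k + (q - p)) := by
      intro k hk
      simp only [om]
      rw [hf2 k hk]
      by_cases h : k + (q - p) < n
      · rw [if_pos h, if_pos (by omega)]
      · rw [if_neg h, if_neg (by omega)]
    rcases lt_trichotomy k p with h | h | h
    · rw [hal1 k h.le, hom1 k h]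
      exact (hV.link k (by omega)).mono hZ
    · subst h
      rw [hal1 k le_rfl, hom2 k le_rfl, show k + (q - k) = q by omega]
      exact Or.inr hcn
    · rw [hal2 k h, hom2 k h.le]
      exact (hV.link _ (by omega)).mono hZ
  · intro h
    obtain rfl : p = 0 := by omega
    obtain rfl : q = n := by omega
    simp only [om, lt_irrefl, if_false, al] at hcn
    exact hcn.mono Set.subset_union_left

/-- labels after `k` jumps -/
def lab (v : ℕ → Vis V K) : ℕ → Equiv.Perm (Option (Fin K))
  | 0 => 1
  | k + 1 => lab v k * Equiv.swap none (some (v k).i)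

/-- current base point on each line -/
def bt (v : ℕ → Vis V K) : ℕ → Fin K → ℕ
  | 0, _ => 0
  | k + 1, i => if (v k).i = i then (v k).b else bt v k i

theorem lab_none (v : ℕ → Vis V K) (k : ℕ) : lab v (k + 1) none = lab v k (some (v k).i) := by
  simp [lab]

theorem lab_self (v : ℕ → Vis V K) (k : ℕ) : lab v (k + 1) (some (v k).i) = lab v k none := by
  simp [lab]

theorem lab_other (v : ℕ → Vis V K) (k : ℕ) (i : Fin K) (h : (v k).i ≠ i) :
    lab v (k + 1) (some i) = lab v k (some i) := by
  simp only [lab, Equiv.Perm.mul_apply]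
  rw [Equiv.swap_apply_of_ne_of_ne (by simp) (by simpa using h.symm)]

/-- between -/
def btw (a p b : ℕ) : Prop := (a ≤ p ∧ p ≤ b) ∨ (b ≤ p ∧ p ≤ a)

/-- labelled line points -/
def LP (L : Lines V K) (n : ℕ) (v : ℕ → Vis V K) (i : Fin K) (p : ℕ) (o : Option (Fin K)) : Prop :=
  (∃ k < n, (v k).i = i ∧ btw (bt v k i) p (v k).e ∧ o = lab v k (some i)) ∨
  (btw (bt v n i) p (L.N i) ∧ o = lab v n (some i))

theorem bt_cases (v : ℕ → Vis V K) (k : ℕ) (i : Fin K) :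
    (bt v k i = 0 ∧ ∀ j < k, (v j).i ≠ i) ∨
    ∃ j < k, (v j).i = i ∧ bt v k i = (v j).b ∧ ∀ m, j < m → m < k → (v m).i ≠ i := by
  induction k with
  | zero => left; simp [bt]
  | succ k ih =>
    by_cases h : (v k).i = i
    · right
      exact ⟨k, by omega, h, by simp [bt, h], fun m h1 h2 => by omega⟩
    · have e : bt v (k + 1) i = bt v k i := by simp [bt, h]
      rcases ih with ⟨h1, h2⟩ | ⟨j, hj, h1, h2, h3⟩
      · left
        refine ⟨e.trans h1, fun j hj => ?_⟩
        rcases Nat.lt_succ_iff_lt_or_eq.1 hj with hj | rfl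
        · exact h2 j hj
        · exact h
      · right
        refine ⟨j, by omega, h1, e.trans h2, fun m hm1 hm2 => ?_⟩
        rcases Nat.lt_succ_iff_lt_or_eq.1 hm2 with hj | rfl
        · exact h3 m hm1 hj
        · exact h

theorem bt_le {L : Lines V K} {r n : ℕ} {v : ℕ → Vis V K} (hok : ∀ k < n, (v k).Ok L G r) (k : ℕ)
    (hk : k ≤ n) (i : Fin K) : bt v k i ≤ L.N i := by
  rcases bt_cases v k i with ⟨h1, h2⟩ | ⟨j, hj, h1, h2, h3⟩
  · omega
  · rw [h2, ← h1]
    exact (hok j (by omega)).1.1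

theorem LP.le {L : Lines V K} {r n : ℕ} {v : ℕ → Vis V K} (hok : ∀ k < n, (v k).Ok L G r)
    {i : Fin K} {p : ℕ} {o : Option (Fin K)} (h : LP L n v i p o) : p ≤ L.N i := by
  rcases h with ⟨k, hk, hi, hb, ho⟩ | ⟨hb, ho⟩
  · have h1 := bt_le hok k hk.le i
    have h2 := (hok k hk).2.1
    rw [hi] at h2
    unfold btw at hb
    omega
  · have h1 := bt_le hok n le_rfl i
    unfold btw at hb
    omega

theorem piece_sep {L : Lines V K} {r n h : ℕ} {v : ℕ → Vis V K} (hok : ∀ k < n, (v k).Ok L G r)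
    (hs : Star h n v) {i : Fin K} {k k' p p' : ℕ} (hkk : k < k') (hk : k < n) (hki : (v k).i = i)
    (hp : btw (bt v k i) p (v k).e)
    (hp' : (k' < n ∧ (v k').i = i ∧ btw (bt v k' i) p' (v k').e) ∨
      (k' = n ∧ btw (bt v n i) p' (L.N i))) : p + h ≤ p' := by
  obtain ⟨j, hj, hji, hbj, hlast⟩ : ∃ j < k', (v j).i = i ∧ bt v k' i = (v j).b ∧
      ∀ m, j < m → m < k' → (v m).i ≠ i := by
    rcases bt_cases v k' i with ⟨h1, h2⟩ | h
    · exact absurd hki (h2 k hkk)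
    · exact h
  have hkj : k ≤ j := by
    by_contra hh
    exact hlast k (by omega) hkk hki
  have hjn : j < n := by
    rcases hp' with h | h <;> omega
  have s1j := hs.s1 j hjn
  have s1k := hs.s1 k hk
  have A1 : bt v k i + h ≤ (v j).b := by
    rcases bt_cases v k i with ⟨h1, h2⟩ | ⟨j0, hj0, h1, h2, h3⟩
    · omega
    · have := hs.s2 j0 j (by omega) hjn (h1.trans hji.symm)
      omega
  have A3 : (v k).e + h ≤ (v j).b := by
    rcases Nat.lt_or_eq_of_le hkj with h1 | rfl
    · have := hs.s2 k j h1 hjn (hki.trans hji.symm)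
      omega
    · exact s1k
  rcases hp' with ⟨hk', hi', hb'⟩ | ⟨rfl, hb'⟩
  · have A4 := (hs.s2 k k' hkk hk' (hki.trans hi'.symm)).1
    have A2 : bt v k i + h ≤ (v k').e := by
      rcases bt_cases v k i with ⟨h1, h2⟩ | ⟨j0, hj0, h1, h2, h3⟩
      · omega
      · have := hs.s3 j0 k k' hj0 hkk hk' (h1.trans hki.symm) (hki.trans hi'.symm)
        omega
    unfold btw at hp hb'
    omega
  · have h5 := (hok j hjn).1.1
    rw [hji] at h5
    unfold btw at hp hb'
    omega

theorem LP_eq {L : Lines V K} {r n h h0 : ℕ} {v : ℕ → Vis V K} (hok : ∀ k < n, (v k).Ok L G r)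
    (hs : Star h n v) (hh : h0 < h) {i : Fin K} {p p' : ℕ} {o o' : Option (Fin K)}
    (h1 : LP L n v i p o) (h2 : LP L n v i p' o') (h3 : p ≤ p' + h0) (h4 : p' ≤ p + h0) :
    o = o' := by
  rcases h1 with ⟨k, hk, hi, hb, ho⟩ | ⟨hb, ho⟩ <;>
    rcases h2 with ⟨k', hk', hi', hb', ho'⟩ | ⟨hb', ho'⟩
  · rcases lt_trichotomy k k' with h | rfl | h
    · have := piece_sep hok hs h hk hi hb (Or.inl ⟨hk', hi', hb'⟩)
      omega
    · rw [ho, ho']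
    · have := piece_sep hok hs h hk' hi' hb' (Or.inl ⟨hk, hi, hb⟩)
      omega
  · have := piece_sep hok hs hk hk hi hb (Or.inr ⟨rfl, hb'⟩)
    omega
  · have := piece_sep hok hs hk' hk' hi' hb' (Or.inr ⟨rfl, hb⟩)
    omega
  · rw [ho, ho']

theorem LP_bt {L : Lines V K} {r n : ℕ} {v : ℕ → Vis V K} (hok : ∀ k < n, (v k).Ok L G r)
    (j : ℕ) : ∀ m, m + j = n → ∀ i, LP L n v i (bt v m i) (lab v m (some i)) := by
  induction j with
  | zero =>
    intro m hm i
    obtain rfl : m = n := by omega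
    exact Or.inr ⟨Or.inl ⟨le_rfl, bt_le hok m le_rfl i⟩, rfl⟩
  | succ j ih =>
    intro m hm i
    by_cases hi : (v m).i = i
    · refine Or.inl ⟨m, by omega, hi, ?_, rfl⟩
      unfold btw
      omega
    · have := ih (m + 1) (by omega) i
      rw [lab_other v m i hi] at this
      simpa [bt, hi] using this

/-- label of an end of a visit -/
def endlab (v : ℕ → Vis V K) (k : ℕ) (β : Bool) : Option (Fin K) :=
  if β then lab v k none else lab v (k + 1) none

theorem LP_end {L : Lines V K} {r n : ℕ} {v : ℕ → Vis V K} (hok : ∀ k < n, (v k).Ok L G r)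
    (k : ℕ) (hk : k < n) (β : Bool) : LP L n v (v k).i ((v k).pos β) (endlab v k β) := by
  cases β
  · refine Or.inl ⟨k, hk, rfl, ?_, by simp [endlab, lab_none]⟩
    simp only [Vis.pos, btw]
    simp
    omega
  · have := LP_bt hok (n - (k + 1)) (k + 1) (by omega) (v k).i
    rw [lab_self] at this
    simpa [bt, Vis.pos, endlab] using this

end CM

namespace CM
variable {V : Type*} {G : SimpleGraph V} {K : ℕ}

theorem line_cn {L : Lines V K} {i : Fin K} (h : ∀ p < L.N i, G.Adj (L.P i p) (L.P i (p + 1)))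
    {Y : Set V} {p q : ℕ} (hp : p ≤ L.N i) (hq : q ≤ L.N i)
    (hY : ∀ x, btw p x q → L.P i x ∈ Y) : cn G Y (L.P i p) (L.P i q) := by
  have key : ∀ m p, p + m ≤ L.N i → (∀ x, p ≤ x → x ≤ p + m → L.P i x ∈ Y) →
      cn G Y (L.P i p) (L.P i (p + m)) := by
    intro m
    induction m with
    | zero => exact fun p _ hx => cn_refl (hx p le_rfl le_rfl)
    | succ m ih =>
      intro p hm hx
      exact (ih p (by omega) (fun x h1 h2 => hx x h1 (by omega))).trans
        (cn_adj (h (p + m) (by omega)) (hx _ (by omega) (by omega)) (hx _ (by omega) (by omega)))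
  rcases le_total p q with hpq | hpq
  · obtain ⟨k, rfl⟩ := Nat.exists_eq_add_of_le hpq
    exact key k p hq (fun x h1 h2 => hY x (Or.inl ⟨h1, h2⟩))
  · obtain ⟨k, rfl⟩ := Nat.exists_eq_add_of_le hpq
    exact (key k q hp (fun x h1 h2 => hY x (Or.inr ⟨h1, h2⟩))).symm

/-- the vertices of label `o` -/
def Yset (L : Lines V K) (G : SimpleGraph V) (n : ℕ) (v : ℕ → Vis V K) (Z : Set V) (s : V)
    (o : Option (Fin K)) : Set V :=
  {x | (∃ i p, LP L n v i p o ∧ x = L.P i p) ∨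
    (∃ k < n, ∃ β, endlab v k β = o ∧ Stub L G ((v k).top β) (v k).i ((v k).pos β) x) ∨
    (∃ k ≤ n, lab v k none = o ∧ cn G Z (al s v k) x)}

/-- current target point -/
def tgt (L : Lines V K) (v : ℕ → Vis V K) (s : V) (m : ℕ) : Option (Fin K) → V
  | none => al s v m
  | some i => L.P i (bt v m i)

theorem walks {L : Lines V K} {r n D h0 : ℕ} {v : ℕ → Vis V K} {Z S T : Set V} {s t : V}
    (hok : ∀ k < n, (v k).Ok L G r) (hL : L.Good G D h0) (hs : s ∈ S) (ht : t ∈ T)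
    (hS : ∀ i, L.P i 0 ∈ S) (hT : ∀ i, L.P i (L.N i) ∈ T)
    (link : ∀ k ≤ n, Cn G Z (al s v k) (om t n v k)) (zero : n = 0 → cn G Z s t)
    (o : Option (Fin K)) : ∃ x ∈ S, ∃ y ∈ T, cn G (Yset L G n v Z s o) x y := by
  have jump : ∀ k ≤ n, Cn G (Yset L G n v Z s (lab v k none)) (al s v k) (om t n v k) := by
    intro k hk
    rcases link k hk with h | h
    · exact Or.inl h
    · right
      obtain ⟨w, hw⟩ := h
      refine ⟨w, fun u hu => Or.inr (Or.inr ⟨k, hk, rfl, ?_⟩)⟩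
      obtain ⟨q, q', -, hq, -, -⟩ := walk_split w hu
      exact ⟨q, fun z hz => hw z (hq z hz)⟩
  have stub : ∀ k < n, ∀ β, cn G (Yset L G n v Z s (endlab v k β)) ((v k).top β)
      (L.P (v k).i ((v k).pos β)) := by
    intro k hk β
    exact (stub_walk ((hok k hk).att β)).mono (fun x hx => Or.inr (Or.inl ⟨k, hk, β, rfl, hx⟩))
  have main : ∀ m ≤ n, ∀ pos, ∃ x ∈ S, cn G (Yset L G n v Z s (lab v m pos)) x (tgt L v s m pos) := by
    intro m
    induction m with
    | zero =>
      intro _ pos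
      rcases pos with _ | i
      · refine ⟨s, hs, cn_refl ?_⟩
        rcases Nat.eq_zero_or_pos n with h0 | h0
        · exact Or.inr (Or.inr ⟨0, by omega, rfl, cn_refl (zero h0).left⟩)
        · rcases link 0 (by omega) with h | h
          · refine Or.inr (Or.inl ⟨0, h0, true, by simp [endlab], ?_⟩)
            have e : s = (v 0).top true := by
              simpa [al, om, h0, Vis.top] using h
            rw [e]
            exact stub_top ((hok 0 h0).att true)
          · exact Or.inr (Or.inr ⟨0, by omega, rfl, cn_refl h.left⟩)
      · exact ⟨L.P i 0, hS i, cn_refl (Or.inl ⟨i, 0, LP_bt hok n 0 (by omega) i, rfl⟩)⟩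
    | succ m ih =>
      intro hm pos
      have hmn : m < n := hm
      rcases pos with _ | i
      · obtain ⟨x, hx, hc⟩ := ih (by omega) (some (v m).i)
        refine ⟨x, hx, ?_⟩
        have hst := stub m hmn false
        simp only [endlab, Bool.false_eq_true, if_false] at hst
        rw [lab_none] at hst ⊢
        refine (hc.trans ?_).trans hst.symm
        refine line_cn (hL.adj _) (bt_le hok m hmn.le _) (hok m hmn).2.1 ?_
        intro q hq
        exact Or.inl ⟨_, q, Or.inl ⟨m, hmn, rfl, hq, rfl⟩, rfl⟩
      · by_cases hi : (v m).i = i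
        · subst hi
          obtain ⟨x, hx, hc⟩ := ih (by omega) none
          refine ⟨x, hx, ?_⟩
          have hst := stub m hmn true
          simp only [endlab, if_true] at hst
          rw [lab_self]
          have e : tgt L v s (m + 1) (some (v m).i) = L.P (v m).i ((v m).pos true) := by
            simp [tgt, bt, Vis.pos]
          rw [e]
          have hj := jump m hmn.le
          have e2 : om t n v m = (v m).top true := by simp [om, hmn, Vis.top]
          rw [e2] at hj
          refine cn.trans ?_ hst
          rcases hj with hj | hj
          · rw [← hj]
            exact hc
          · exact hc.trans hj
        · obtain ⟨x, hx, hc⟩ := ih (by omega) (some i)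
          refine ⟨x, hx, ?_⟩
          rw [lab_other v m i hi]
          simpa [tgt, bt, hi] using hc
  obtain ⟨pos, rfl⟩ := (lab v n).surjective o
  obtain ⟨x, hx, hc⟩ := main n le_rfl pos
  rcases pos with _ | i
  · refine ⟨x, hx, t, ht, ?_⟩
    have hj := jump n le_rfl
    have e2 : om t n v n = t := by simp [om]
    rw [e2] at hj
    rcases hj with hj | hj
    · rw [← hj]
      exact hc
    · exact hc.trans hj
  · refine ⟨x, hx, L.P i (L.N i), hT i, hc.trans ?_⟩
    refine line_cn (hL.adj _) (bt_le hok n le_rfl _) le_rfl ?_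
    intro q hq
    exact Or.inl ⟨i, q, Or.inr ⟨hq, rfl⟩, rfl⟩

theorem same_type {h h0 n0 : ℕ} {v0 : ℕ → Vis V K} (hs : Star h n0 v0) (hh : 2 * h0 < h)
    {k k' : ℕ} {β : Bool} (hk : k < n0) (hk' : k' < n0) (hi : (v0 k).i = (v0 k').i)
    (h1 : (v0 k).pos β ≤ (v0 k').pos β + 2 * h0) (h2 : (v0 k').pos β ≤ (v0 k).pos β + 2 * h0) :
    k = k' := by
  rcases lt_trichotomy k k' with h | h | h
  · have := hs.s2 k k' h hk' hi
    cases β <;> simp [Vis.pos] at h1 h2 <;> omega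
  · exact h
  · have := hs.s2 k' k h hk hi.symm
    cases β <;> simp [Vis.pos] at h1 h2 <;> omega

theorem distances {L : Lines V K} {r ρ0 ρ1 c a d D h h0 M n0 n : ℕ} {v0 : ℕ → Vis V K} {Z : Set V}
    {s t : V} {f : ℕ → ℕ} (hL : L.Good G D h0) (hno : ¬ HasNSubdivision G (binTree d) a)
    (hok0 : ∀ k < n0, (v0 k).Ok L G r) (hs0 : Star h n0 v0) (hh : h = 2 * h0 + 1)
    (hV : Valid L G r ρ0 ρ1 h0 n0 a v0 s t n f Z)
    (hcl : ∀ x ∈ Z, ∀ y ∈ Z, nb G a x y → cn G Z x y)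
    (hmin : ∀ p q, p < q → q ≤ n → ¬ cn G Z (al s (fun k => v0 (f k)) p)
        (om t n (fun k => v0 (f k)) q))
    (hca : c ≤ a) (hM : M = d * a) (hρ1 : ρ1 = M + c) (hρ0 : ρ0 = M + c + ρ1)
    (hr : r = M + c + ρ0) (hD : 2 * r + 2 + c + M ≤ D) {o o' : Option (Fin K)} (hne : o ≠ o')
    {x y : V} (hx : x ∈ Yset L G n (fun k => v0 (f k)) Z s o)
    (hy : y ∈ Yset L G n (fun k => v0 (f k)) Z s o') : ¬ nb G c x y := by
  set v : ℕ → Vis V K := fun k => v0 (f k) with hv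
  have hok : ∀ k < n, (v k).Ok L G r := fun k hk => hok0 _ (hV.lt k hk)
  have hs : Star h n v := by
    constructor
    · exact fun k hk => hs0.s1 _ (hV.lt k hk)
    · exact fun j k hjk hk => hs0.s2 _ _ (hV.mono j k hjk hk) (hV.lt k hk)
    · exact fun j k m hjk hkm hm => hs0.s3 _ _ _ (hV.mono j k hjk (by omega))
        (hV.mono k m hkm hm) (hV.lt m hm)
  have hfinj : ∀ j k, j < n → k < n → f j = f k → j = k := by
    intro j k hj hk he
    rcases lt_trichotomy j k with h | h | h
    · have := hV.mono j k h hk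
      omega
    · exact h
    · have := hV.mono k j h hj
      omega
  have hlink : ∀ k ≤ n, Cn G Z (al s v k) (om t n v k) := hV.link
  -- vertices of Z are far from the lines
  have hZfar : ∀ z ∈ Z, ¬ nbP L G c z := by
    intro z hz hn
    obtain ⟨b, hb, hc⟩ := hV.cert.near hno hz
    refine Bset_far (by omega) (by omega) hb ?_
    rw [hρ1]
    exact (hn.move hc.nb.symm).mono (by omega)
  -- Z versus Z
  have hZZ : ∀ k k' x y, k ≤ n → k' ≤ n → lab v k none ≠ lab v k' none → cn G Z (al s v k) x →
      cn G Z (al s v k') y → ¬ cn G Z x y := by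
    have key : ∀ k k' x y, k < k' → k' ≤ n → cn G Z (al s v k) x →
        cn G Z (al s v k') y → ¬ cn G Z x y := by
      intro k k' x y hkk hk' h1 h2 h3
      have h4 := (h1.trans h3).trans h2.symm
      rcases hlink k' hk' with h5 | h5
      · rw [h5] at h4
        exact hmin k k' hkk hk' h4
      · exact hmin k k' hkk hk' (h4.trans h5)
    intro k k' x y hk hk' hl h1 h2 h3
    rcases lt_trichotomy k k' with h | h | h
    · exact key k k' x y h hk' h1 h2 h3
    · exact hl (by rw [h])
    · exact key k' k y x h hk h2 h1 h3.symm
  -- tops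
  have htop : ∀ k < n, ∀ β z, cn G Z ((v k).top β) z →
      ∃ k' ≤ n, lab v k' none = endlab v k β ∧ cn G Z (al s v k') z := by
    intro k hk β z hz
    cases β
    · exact ⟨k + 1, hk, by simp [endlab], hz⟩
    · refine ⟨k, hk.le, by simp [endlab], ?_⟩
      have e2 : om t n v k = (v k).top true := by simp [om, hk, Vis.top]
      have := hlink k hk.le
      rw [e2] at this
      rcases this with h | h
      · rw [h]; exact hz
      · exact h.trans hz
  -- points near lines
  have hNN : ∀ i p i' p' x y (o o' : Option (Fin K)), o ≠ o' → LP L n v i p o → LP L n v i' p' o' →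
      nb G (r + 1) x (L.P i p) → nb G (r + 1) y (L.P i' p') → ¬ nb G c x y := by
    intro i p i' p' x y o o' hoo h1 h2 h3 h4 h5
    obtain ⟨e, h6, h7⟩ := hL.st i i' p p' (h1.le hok) (h2.le hok)
      (((h3.symm.trans h5).trans h4).mono (by omega))
    subst e
    exact hoo (LP_eq hok hs (by omega) h1 h2 h6 h7)
  have hSZ : ∀ k < n, ∀ β k' z y, k' ≤ n → lab v k' none ≠ endlab v k β →
      Stub L G ((v k).top β) (v k).i ((v k).pos β) z → cn G Z (al s v k') y → ¬ nb G c z y := by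
    intro k hk β k' z y hk' hlab hst hy hnb
    have hyZ : y ∈ Z := hy.right
    have contra : ∀ j < n, ∀ γ, endlab v j γ = endlab v k β → ¬ cn G Z ((v j).top γ) y := by
      intro j hj γ he hc
      obtain ⟨k1, hk1, hl1, hc1⟩ := htop j hj γ y hc
      refine hZZ k' k1 y y hk' hk1 ?_ hy hc1 (cn_refl hyZ)
      rw [hl1, he]
      exact hlab
    have up : ∀ ρ, ¬ nbP L G ρ z →
        (∀ u, Stub L G ((v k).top β) (v k).i ((v k).pos β) u → ¬ nbP L G ρ u → u ∈ Z) → False := by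
      intro ρ hz hsub
      have h1 := (stub_conn ((hok k hk).att β).1 hst hz).mono (Z' := Z)
        (fun u hu => hsub u hu.1 hu.2)
      exact contra k hk β rfl (h1.trans (hcl z h1.right y hyZ (hnb.mono hca)))
    obtain ⟨y0, hy0, hcy0⟩ := hV.cert.near hno hyZ
    rw [← hM] at hcy0
    have place : ∀ j < n0, ∀ γ, Stub L G ((v0 j).top γ) (v0 j).i ((v0 j).pos γ) y0 →
        SP h0 (v k) (v0 j) β γ := by
      intro j hj γ hsj
      have n1 := hst.nb ((hok k hk).att β)
      have n2 := hsj.nb ((hok0 j hj).att γ)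
      exact hL.st _ _ _ _ ((hok k hk).att β).1 ((hok0 j hj).att γ).1
        ((((n1.symm.trans hnb).trans hcy0.nb).trans n2).mono (by omega))
    have down : ∀ ρ j γ, j < n0 → Stub L G ((v0 j).top γ) (v0 j).i ((v0 j).pos γ) y0 →
        ¬ nbP L G ρ y0 →
        (∀ u, Stub L G ((v0 j).top γ) (v0 j).i ((v0 j).pos γ) u → ¬ nbP L G ρ u → u ∈ Z) →
        cn G Z ((v0 j).top γ) y := by
      intro ρ j γ hj hsj hz hsub
      have h1 := (stub_conn ((hok0 j hj).att γ).1 hsj hz).mono (Z' := Z)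
        (fun u hu => hsub u hu.1 hu.2)
      exact h1.trans hcy0.cn.symm
    by_cases halone : ∀ j γ, (∃ i < n, f i = j) → SP h0 (v0 j) (v k) γ β → j = f k ∧ γ = β
    · by_cases hz : nbP L G ρ1 z
      · have hn0 : nbP L G ρ0 y0 := by
          rw [hρ0]
          exact (hz.move (hcy0.nb.symm.trans hnb.symm)).mono (by omega)
        rcases hy0 with h1 | ⟨j, hj, γ, hsj, h1 | ⟨h1, h2⟩⟩
        · exact h1 (hn0.mono (by omega))
        · exact h1 hn0
        · have hsp := place j hj γ hsj
          obtain ⟨e1, e2⟩ := h2 (f k) β ⟨k, hk, rfl⟩ hsp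
          have := down ρ1 j γ hj hsj h1 (fun u hu1 hu2 => hV.sub
            (Or.inr ⟨j, hj, γ, hu1, Or.inr ⟨hu2, h2⟩⟩))
          rw [← e1, ← e2] at this
          exact contra k hk β rfl this
      · exact up ρ1 hz (fun u hu1 hu2 => hV.sub
          (Or.inr ⟨f k, hV.lt k hk, β, hu1, Or.inr ⟨hu2, halone⟩⟩))
    · by_cases hz : nbP L G ρ0 z
      · push Not at halone
        obtain ⟨j', γ', ⟨i', hi', rfl⟩, hsp', hne'⟩ := halone
        have hn0 : nbP L G r y0 := by
          rw [hr]
          exact (hz.move (hcy0.nb.symm.trans hnb.symm)).mono (by omega)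
        obtain ⟨j, hj, γ, hsj, hcon⟩ : ∃ j < n0, ∃ γ,
            Stub L G ((v0 j).top γ) (v0 j).i ((v0 j).pos γ) y0 ∧ cn G Z ((v0 j).top γ) y := by
          rcases hy0 with h1 | ⟨j, hj, γ, hsj, h1 | ⟨h1, h2⟩⟩
          · exact absurd hn0 h1
          · exact ⟨j, hj, γ, hsj, down ρ0 j γ hj hsj h1 (fun u hu1 hu2 => hV.sub
              (Or.inr ⟨j, hj, γ, hu1, Or.inl hu2⟩))⟩
          · exact ⟨j, hj, γ, hsj, down ρ1 j γ hj hsj h1 (fun u hu1 hu2 => hV.sub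
              (Or.inr ⟨j, hj, γ, hu1, Or.inr ⟨hu2, h2⟩⟩))⟩
        have hsp := place j hj γ hsj
        obtain ⟨a1, a2, a3⟩ := hsp
        obtain ⟨b1, b2, b3⟩ := hsp'
        have hγ' : γ' ≠ β := by
          rintro rfl
          exact hne' (same_type (β := γ') (h0 := h0) hs0 (by omega) (hV.lt i' hi') (hV.lt k hk) b1
            (by simp only [hv] at b2; omega) (by simp only [hv] at b3; omega)) rfl
        by_cases hγ : γ = β
        · subst hγ
          have e := same_type (β := γ) (h0 := h0) hs0 (by omega) (hV.lt k hk) hj a1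
            (by simp only [hv] at a2; omega) (by simp only [hv] at a3; omega)
          rw [← e] at hcon
          exact contra k hk γ rfl hcon
        · have hγγ : γ = γ' := by
            revert hγ hγ'
            cases γ <;> cases γ' <;> cases β <;> simp
          subst hγγ
          have e := same_type (β := γ) (h0 := h0) hs0 (by omega) (hV.lt i' hi') hj (b1.trans a1)
            (by simp only [hv] at a2 b2 a3 b3; omega) (by simp only [hv] at a2 b2 a3 b3; omega)
          rw [← e] at hcon
          refine contra i' hi' γ ?_ hcon
          have l1 := LP_end hok i' hi' γ
          have l2 := LP_end hok k hk β
          have b1' : (v i').i = (v k).i := b1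
          rw [b1'] at l1
          exact LP_eq hok hs (by omega) l1 l2 b2 b3
      · exact up ρ0 hz (fun u hu1 hu2 => hV.sub
          (Or.inr ⟨f k, hV.lt k hk, β, hu1, Or.inl hu2⟩))
  rcases hx with ⟨i, p, hlp, rfl⟩ | ⟨k, hk, β, hl, hst⟩ | ⟨k, hk, hl, hcz⟩
  · rcases hy with ⟨i', p', hlp', rfl⟩ | ⟨k', hk', β', hl', hst'⟩ | ⟨k', hk', hl', hcz'⟩
    · exact hNN _ _ _ _ _ _ o o' hne hlp hlp' (nb_refl _ _) (nb_refl _ _)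
    · exact hNN _ _ _ _ _ _ o o' hne hlp (hl' ▸ LP_end hok k' hk' β') (nb_refl _ _)
        (hst'.nb ((hok k' hk').att β'))
    · exact fun hn => hZfar y hcz'.right ⟨i, p, hlp.le hok, hn.symm⟩
  · rcases hy with ⟨i', p', hlp', rfl⟩ | ⟨k', hk', β', hl', hst'⟩ | ⟨k', hk', hl', hcz'⟩
    · exact hNN _ _ _ _ _ _ o o' hne (hl ▸ LP_end hok k hk β) hlp'
        (hst.nb ((hok k hk).att β)) (nb_refl _ _)
    · exact hNN _ _ _ _ _ _ o o' hne (hl ▸ LP_end hok k hk β) (hl' ▸ LP_end hok k' hk' β')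
        (hst.nb ((hok k hk).att β)) (hst'.nb ((hok k' hk').att β'))
    · exact hSZ k hk β k' x y hk' (by rw [hl, hl']; exact hne.symm) hst hcz'
  · rcases hy with ⟨i', p', hlp', rfl⟩ | ⟨k', hk', β', hl', hst'⟩ | ⟨k', hk', hl', hcz'⟩
    · exact fun hn => hZfar x hcz.right ⟨i', p', hlp'.le hok, hn⟩
    · exact fun hn => hSZ k' hk' β' k y x hk (by rw [hl, hl']; exact hne) hst' hcz hn.symm
    · exact fun hn => hZZ k k' x y hk hk' (by rw [hl, hl']; exact hne) hcz hcz'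
        (hcl x hcz.right y hcz'.right (hn.mono hca))

end CM

namespace CM
variable {V : Type*} {G : SimpleGraph V} {K : ℕ}

theorem lt_eSetDist {A B : Set V} {c : ℕ} (h : ∀ a ∈ A, ∀ b ∈ B, ¬ nb G c a b) :
    (c : ℕ∞) < eSetDist G A B := by
  have h1 : ((c + 1 : ℕ) : ℕ∞) ≤ eSetDist G A B := by
    refine le_sInf ?_
    rintro n ⟨a, b, w, ha, hb, rfl⟩
    have : ¬ w.length ≤ c := fun hw => h a ha b hb ⟨w, hw⟩
    exact_mod_cast (by omega : c + 1 ≤ w.length)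
  exact lt_of_lt_of_le (by exact_mod_cast Nat.lt_succ_self c) h1

theorem not_nb_of_lt {A B : Set V} {c : ℕ} (h : (c : ℕ∞) < eSetDist G A B) {a b : V}
    (ha : a ∈ A) (hb : b ∈ B) : ¬ nb G c a b := by
  rintro ⟨w, hw⟩
  have h1 : eSetDist G A B ≤ (w.length : ℕ∞) := sInf_le ⟨a, b, w, ha, hb, rfl⟩
  have h2 : (w.length : ℕ∞) ≤ c := by exact_mod_cast hw
  exact absurd (lt_of_lt_of_le h (h1.trans h2)) (lt_irrefl _)

theorem eSetDist_le {x y : V} {l : ℕ} (h : nb G l y x) : eSetDist G {y} {x} ≤ (l : ℕ∞) := by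
  obtain ⟨w, hw⟩ := h
  have h1 : eSetDist G {y} {x} ≤ (w.length : ℕ∞) := sInf_le ⟨y, x, w, rfl, rfl, rfl⟩
  exact h1.trans (by exact_mod_cast hw)

theorem HasNSubdivision_mono {W : Type*} {H : SimpleGraph W} {m n : ℕ} (hmn : m ≤ n)
    (h : HasNSubdivision G H m) : HasNSubdivision G H n := by
  obtain ⟨f, P, h1, h2, h3, h4, h5⟩ := h
  exact ⟨f, P, h1, h2, fun a b hab => ⟨(h3 a b hab).1, (h3 a b hab).2.trans hmn⟩, h4, h5⟩

/-- the two outcomes -/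
theorem step [Finite V] {k d c a M ρ1 ρ0 r D h0 h g Γ : ℕ} (ha : a = c) (hM : M = d * a)
    (hρ1 : ρ1 = M + c) (hρ0 : ρ0 = M + c + ρ1) (hr : r = M + c + ρ0) (hD : D = 2 * r + 3 + c + M)
    (hh0 : h0 = (2 * d * D + 1) * D) (hh : h = 2 * h0 + 1) (hg : g = 2 * h) (hΓ : Γ = 3 * g)
    (hno : ¬ HasNSubdivision G (binTree d) a) (hno' : ¬ HasNSubdivision G (binTree d) D)
    {S T : Set V} (u v : Fin (k + 1) → V) (w : ∀ i, G.Walk (u i) (v i)) (hu : ∀ i, u i ∈ S)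
    (hv : ∀ i, v i ∈ T) (hfar : ∀ i j, i ≠ j → ∀ x ∈ (w i).support, ∀ y ∈ (w j).support,
      ¬ nb G (D + 2 * (d * D)) x y) :
    (∃ (u v : Fin (k + 1 + 1) → V) (P : ∀ i, G.Walk (u i) (v i)),
          (∀ i, u i ∈ S) ∧ (∀ i, v i ∈ T) ∧
          (∀ i j, i ≠ j → ∀ x ∈ (P i).support, ∀ y ∈ (P j).support, ¬ nb G c x y)) ∨
    ∃ X : Finset V, X.card ≤ k + 1 ∧ ∀ (s t : V) (w : G.Walk s t), s ∈ S → t ∈ T →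
      ∃ y ∈ w.support, ∃ x ∈ X, nb G (r + 1 + Γ + h0) y x := by
  obtain ⟨N, P, h1, h2, h3, h4⟩ := straighten hno' u v w hu hv hfar
  let L : Lines V (k + 1) := ⟨N, P⟩
  have hL : L.Good G D h0 := ⟨h3, by rw [hh0]; exact h4⟩
  by_cases hT : ∀ t ∈ T, ¬ goodv L G r Γ S t
  · exact Or.inr (separation hL (by omega) hT)
  · push Not at hT
    left
    obtain ⟨s, hs, t, ht, n0, v0, hok0, hlink0, hstar, hzero⟩ := selection hg hΓ hT
    obtain ⟨n, f, Z, hV, hcl, hmin⟩ :=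
      exists_minimal (ρ0 := ρ0) (ρ1 := ρ1) (h0 := h0) hno hlink0 hzero
    have hw := walks (fun k hk => hok0 _ (hV.lt k hk)) hL hs ht h1 h2 hV.link hV.zero
    choose x hx y hy q hq using hw
    have e := finSuccEquiv (k + 1)
    refine ⟨fun i => x (e i), fun i => y (e i), fun i => q (e i), fun i => hx _, fun i => hy _, ?_⟩
    intro i j hij a1 ha1 b1 hb1
    exact distances hL hno hok0 hstar hh hV hcl hmin ha.ge hM hρ1 hρ0 hr (by omega)
      (fun he => hij (e.injective he)) (hq _ _ ha1) (hq _ _ hb1)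

theorem main (k d : ℕ) : ∀ c : ℕ,
    ∃ ℓ₁ ℓ₂ : ℕ, ∀ (V : Type) [Fintype V], ∀ G : SimpleGraph V,
      ¬ HasNSubdivision G (binTree d) ℓ₁ →
      ∀ S T : Set V,
        (∃ (u v : Fin (k + 1) → V) (P : ∀ i, G.Walk (u i) (v i)),
          (∀ i, u i ∈ S) ∧ (∀ i, v i ∈ T) ∧
          (∀ i j, i ≠ j → ∀ x ∈ (P i).support, ∀ y ∈ (P j).support, ¬ nb G c x y)) ∨
        (∃ X : Finset V, X.card ≤ k ∧ ∀ (s t : V) (w : G.Walk s t), s ∈ S → t ∈ T →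
      ∃ y ∈ w.support, ∃ x ∈ X, nb G ℓ₂ y x) := by
  induction k with
  | zero =>
    intro c
    refine ⟨0, 0, fun V _ G _ S T => ?_⟩
    by_cases h : ∃ s ∈ S, ∃ t ∈ T, Nonempty (G.Walk s t)
    · obtain ⟨s, hs, t, ht, ⟨w⟩⟩ := h
      exact Or.inl ⟨fun _ => s, fun _ => t, fun _ => w, fun _ => hs, fun _ => ht,
        fun i j hij => absurd (Subsingleton.elim (α := Fin 1) i j) hij⟩
    · exact Or.inr ⟨∅, by simp, fun s t w hs ht => absurd ⟨s, hs, t, ht, ⟨w⟩⟩ h⟩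
  | succ k ih =>
    intro c
    obtain ⟨M, hM⟩ : ∃ M, M = d * c := ⟨_, rfl⟩
    obtain ⟨ρ1, hρ1⟩ : ∃ ρ1, ρ1 = M + c := ⟨_, rfl⟩
    obtain ⟨ρ0, hρ0⟩ : ∃ ρ0, ρ0 = M + c + ρ1 := ⟨_, rfl⟩
    obtain ⟨r, hr⟩ : ∃ r, r = M + c + ρ0 := ⟨_, rfl⟩
    obtain ⟨D, hD⟩ : ∃ D, D = 2 * r + 3 + c + M := ⟨_, rfl⟩
    obtain ⟨h0, hh0⟩ : ∃ h0, h0 = (2 * d * D + 1) * D := ⟨_, rfl⟩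
    obtain ⟨h, hh⟩ : ∃ h, h = 2 * h0 + 1 := ⟨_, rfl⟩
    obtain ⟨g, hg⟩ : ∃ g, g = 2 * h := ⟨_, rfl⟩
    obtain ⟨Γ, hΓ⟩ : ∃ Γ, Γ = 3 * g := ⟨_, rfl⟩
    obtain ⟨l1, l2, H⟩ := ih (D + 2 * (d * D))
    refine ⟨max l1 (max c D), max l2 (r + 1 + Γ + h0), fun V _ G hno S T => ?_⟩
    rcases H V G (fun hh => hno (HasNSubdivision_mono (le_max_left _ _) hh)) S T with
      ⟨u, v, w, hu, hv, hfar⟩ | ⟨X, hX, hX2⟩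
    · rcases step (k := k) rfl hM hρ1 hρ0 hr hD hh0 hh hg hΓ
        (fun hh => hno (HasNSubdivision_mono (by omega) hh))
        (fun hh => hno (HasNSubdivision_mono (by omega) hh)) u v w hu hv hfar with h1 | ⟨X, hX, hX2⟩
      · exact Or.inl h1
      · refine Or.inr ⟨X, hX, fun s t w hs ht => ?_⟩
        obtain ⟨y, hy, x, hx, hn⟩ := hX2 s t w hs ht
        exact ⟨y, hy, x, hx, hn.mono (le_max_right _ _)⟩
    · refine Or.inr ⟨X, by omega, fun s t w hs ht => ?_⟩
      obtain ⟨y, hy, x, hx, hn⟩ := hX2 s t w hs ht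
      exact ⟨y, hy, x, hx, hn.mono (le_max_left _ _)⟩

end CM

/-- Coarse Menger for graphs with no `ℓ₁`-subdivision of the uniform binary tree `H_d`. -/
theorem coarseMenger_of_no_binTree_subdivision (k d c : ℕ) :
    ∃ ℓ₁ ℓ₂ : ℕ, ∀ (V : Type) [Fintype V], ∀ G : SimpleGraph V,
      ¬ HasNSubdivision G (binTree d) ℓ₁ →
      ∀ S T : Set V,
        (∃ (u v : Fin (k + 1) → V) (P : ∀ i, G.Walk (u i) (v i)),
          (∀ i, (P i).IsPath) ∧ (∀ i, u i ∈ S) ∧ (∀ i, v i ∈ T) ∧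
          (∀ i j, i ≠ j →
            (c : ℕ∞) < eSetDist G {x | x ∈ (P i).support} {x | x ∈ (P j).support})) ∨
        (∃ X : Finset V, X.card ≤ k ∧
          ∀ (a b : V) (w : G.Walk a b), w.IsPath → a ∈ S → b ∈ T →
            ∃ y ∈ w.support, ∃ x ∈ X, eSetDist G {y} {x} ≤ (ℓ₂ : ℕ∞)) := by
  classical
  obtain ⟨l1, l2, H⟩ := CM.main k d c
  refine ⟨l1, l2, fun V _ G hno S T => ?_⟩
  rcases H V G hno S T with ⟨u, v, w, hu, hv, hfar⟩ | ⟨X, hX, hX2⟩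
  · refine Or.inl ⟨u, v, fun i => (w i).bypass, fun i => (w i).bypass_isPath, hu, hv, ?_⟩
    intro i j hij
    refine CM.lt_eSetDist fun a ha b hb => hfar i j hij a ?_ b ?_
    · exact (w i).support_bypass_subset_support ha
    · exact (w j).support_bypass_subset_support hb
  · refine Or.inr ⟨X, hX, fun a b w _ ha hb => ?_⟩
    obtain ⟨y, hy, x, hx, hn⟩ := hX2 a b w ha hb
    exact ⟨y, hy, x, hx, CM.eSetDist_le hn⟩
end

section
/- For every integer d ≥ 2 there exists an integer k such that every finite simple graph containing no subdivision of the uniform binary tree H_d as a subgraph has path-width at most k; and conversely, every finite simple graph that contains a subdivision of H_d as a subgraph has path-width at least (d−1)/2. -/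
open SimpleGraph

/-- `G` contains a subdivision of `H` as a subgraph: an injection `f` of `V(H)` into `V(G)`
together with, for each edge `ab` of `H`, a path of `G` from `f a` to `f b` of length at
least one, these paths being pairwise vertex-disjoint except for their ends. -/
def HasSubdivision {V W : Type*} (G : SimpleGraph V) (H : SimpleGraph W) : Prop :=
  ∃ (f : W → V) (P : ∀ ⦃a b : W⦄, H.Adj a b → G.Walk (f a) (f b)),
    Function.Injective f ∧
    (∀ a b (h : H.Adj a b), (P h).IsPath) ∧
    (∀ a b (h : H.Adj a b), 1 ≤ (P h).length) ∧
    (∀ a b (h : H.Adj a b), ∀ x ∈ (P h).support, x ∈ Set.range f → x = f a ∨ x = f b) ∧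
    (∀ a b a' b' (h : H.Adj a b) (h' : H.Adj a' b'), s(a, b) ≠ s(a', b') →
      ∀ x ∈ (P h).support, x ∈ (P h').support → x ∈ Set.range f)

/-- `G` has path-width at most `d`. -/
def PathwidthAtMost {V : Type*} (G : SimpleGraph V) (d : ℕ) : Prop :=
  ∃ (n : ℕ) (W : Fin n → Finset V),
    (∀ i, (W i).card ≤ d + 1) ∧
    (∀ v : V, ∃ i, v ∈ W i) ∧
    (∀ u v : V, G.Adj u v → ∃ i, u ∈ W i ∧ v ∈ W i) ∧
    (∀ i j l : Fin n, i ≤ j → j ≤ l → ∀ v : V, v ∈ W i → v ∈ W l → v ∈ W j)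


section
open Classical
set_option linter.unusedSectionVars false

variable {V : Type} [Fintype V]

noncomputable def bd (G : SimpleGraph V) (X : Finset V) : Finset V :=
  X.filter (fun x => ∃ y, y ∉ X ∧ G.Adj x y)

theorem mem_bd {G : SimpleGraph V} {X : Finset V} {x : V} :
    x ∈ bd G X ↔ x ∈ X ∧ ∃ y, y ∉ X ∧ G.Adj x y := by simp [bd]

theorem bd_submod (G : SimpleGraph V) (X Y : Finset V) :
    (bd G (X ∩ Y)).card + (bd G (X ∪ Y)).card ≤ (bd G X).card + (bd G Y).card := by
  rw [← Finset.card_union_add_card_inter, ← Finset.card_union_add_card_inter (bd G X)]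
  apply add_le_add
  · apply Finset.card_le_card
    intro z
    simp only [Finset.mem_union, mem_bd, Finset.mem_inter]
    rintro (⟨⟨h1, h2⟩, y, hy, ha⟩ | ⟨h1, y, hy, ha⟩)
    · by_cases h : y ∈ X
      · exact Or.inr ⟨h2, y, by tauto, ha⟩
      · exact Or.inl ⟨h1, y, h, ha⟩
    · rcases h1 with h1 | h1
      · exact Or.inl ⟨h1, y, by tauto, ha⟩
      · exact Or.inr ⟨h1, y, by tauto, ha⟩
  · apply Finset.card_le_card
    intro z
    simp only [Finset.mem_union, mem_bd, Finset.mem_inter]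
    rintro ⟨⟨⟨h1, h2⟩, y, hy, ha⟩, ⟨h1', y', hy', ha'⟩⟩
    exact ⟨⟨h1, y', by tauto, ha'⟩, ⟨h2, y', by tauto, ha'⟩⟩

inductive Adm (G : SimpleGraph V) (n : ℕ) : Finset V → Prop
  | empty : Adm G n ∅
  | step (X : Finset V) (v : V) : Adm G n X → (bd G X).card < n → Adm G n (insert v X)

theorem Adm.inter {G : SimpleGraph V} {n : ℕ} {X : Finset V} (h : Adm G n X) :
    ∀ Y : Finset V, (∀ Y', Y ⊆ Y' → Y' ⊆ X ∪ Y → (bd G Y).card ≤ (bd G Y').card) →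
      Adm G n (X ∩ Y) := by
  induction h with
  | empty => intro Y _; simpa using Adm.empty
  | step X v hX hc ih =>
    intro Y hY
    have h1 := ih Y (fun Y' h1 h2 => hY Y' h1 (h2.trans (by
      intro z; simp only [Finset.mem_union, Finset.mem_insert]; tauto)))
    by_cases hv : v ∈ Y
    · rw [Finset.insert_inter_of_mem hv]
      apply Adm.step _ _ h1
      have := bd_submod G X Y
      have := hY (X ∪ Y) Finset.subset_union_right (by
        intro z; simp only [Finset.mem_union, Finset.mem_insert]; tauto)
      omega
    · rwa [Finset.insert_inter_of_notMem hv]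

theorem bd_insert_subset (G : SimpleGraph V) (X : Finset V) (v : V) :
    bd G (insert v X) ⊆ insert v (bd G X) := by
  intro z
  simp only [mem_bd, Finset.mem_insert]
  rintro ⟨h1 | h1, y, hy, ha⟩
  · exact Or.inl h1
  · exact Or.inr ⟨h1, y, by tauto, ha⟩

theorem Adm.decomp {G : SimpleGraph V} {n : ℕ} {X : Finset V} (h : Adm G n X) :
    ∃ (N : ℕ) (W : ℕ → Finset V), (∀ i, (W i).card ≤ n) ∧ (∀ i, W i ⊆ X) ∧
      (∀ v ∈ X, ∃ i < N, v ∈ W i) ∧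
      (∀ u ∈ X, ∀ v ∈ X, G.Adj u v → ∃ i < N, u ∈ W i ∧ v ∈ W i) ∧
      (∀ i j l, i ≤ j → j ≤ l → l < N → ∀ v, v ∈ W i → v ∈ W l → v ∈ W j) ∧
      (∀ i j, i ≤ j → j < N → ∀ v ∈ bd G X, v ∈ W i → v ∈ W j) := by
  induction h with
  | empty => exact ⟨0, fun _ => ∅, by simp⟩
  | step X v hX hc ih =>
    by_cases hvX : v ∈ X
    · rwa [Finset.insert_eq_of_mem hvX]
    obtain ⟨N, W, h1, h2, h3, h4, h5, h6⟩ := ih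
    have hb : bd G X ⊆ X := fun z hz => (mem_bd.1 hz).1
    refine ⟨N + 1, fun i => if i < N then W i else insert v (bd G X), ?_, ?_, ?_, ?_, ?_, ?_⟩
    · intro i
      dsimp only
      split_ifs
      · exact h1 i
      · exact (Finset.card_insert_le _ _).trans hc
    · intro i
      dsimp only
      split_ifs
      · exact (h2 i).trans (Finset.subset_insert _ _)
      · exact Finset.insert_subset_insert _ hb
    · intro u hu
      rcases Finset.mem_insert.1 hu with rfl | hu
      · exact ⟨N, by omega, by simp⟩
      · obtain ⟨i, hi, hw⟩ := h3 u hu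
        exact ⟨i, by omega, by simpa [hi] using hw⟩
    · have key : ∀ w ∈ X, G.Adj w v → w ∈ bd G X := fun w hw ha => mem_bd.2 ⟨hw, v, hvX, ha⟩
      intro u hu w hw ha
      rcases Finset.mem_insert.1 hu with rfl | hu1
      · rcases Finset.mem_insert.1 hw with rfl | hw
        · exact ⟨N, by omega, by simp⟩
        · exact ⟨N, by omega, by simp, by simp [key w hw ha.symm]⟩
      · rcases Finset.mem_insert.1 hw with rfl | hw
        · exact ⟨N, by omega, by simp [key u hu1 ha], by simp⟩
        · obtain ⟨i, hi, hw⟩ := h4 u hu1 w hw ha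
          exact ⟨i, by omega, by simpa [hi] using hw⟩
    · intro i j l hij hjl hl u hu hu'
      dsimp only at *
      by_cases hjN : j < N
      · have hiN : i < N := by omega
        simp only [hjN, hiN, if_true] at hu ⊢
        split_ifs at hu' with hlN
        · exact h5 i j l hij hjl hlN u hu hu'
        · rcases Finset.mem_insert.1 hu' with rfl | hu'
          · exact absurd (h2 _ hu) hvX
          · exact h6 i j hij hjN u hu' hu
      · have : ¬ l < N := by omega
        simp only [hjN, this, if_false] at *
        exact hu'
    · intro i j hij hj u hu hui
      dsimp only at *
      have hu := bd_insert_subset G X v hu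
      by_cases hjN : j < N
      · have hiN : i < N := by omega
        simp only [hjN, hiN, if_true] at hui ⊢
        rcases Finset.mem_insert.1 hu with rfl | hu'
        · exact absurd (h2 _ hui) hvX
        · exact h6 i j hij hjN u hu' hui
      · simpa only [hjN, if_false] using hu

theorem Adm.pathwidth {G : SimpleGraph V} {k : ℕ} (h : Adm G (k+1) Finset.univ) :
    PathwidthAtMost G k := by
  obtain ⟨N, W, h1, h2, h3, h4, h5, h6⟩ := h.decomp
  refine ⟨N, fun i => W i, fun i => h1 i, ?_, ?_, ?_⟩
  · intro v
    obtain ⟨i, hi, h⟩ := h3 v (Finset.mem_univ _)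
    exact ⟨⟨i, hi⟩, h⟩
  · intro u v ha
    obtain ⟨i, hi, h⟩ := h4 u (Finset.mem_univ _) v (Finset.mem_univ _) ha
    exact ⟨⟨i, hi⟩, h⟩
  · intro i j l hij hjl v
    exact h5 i j l hij hjl l.2 v

def Conn (G : SimpleGraph V) (C : Set V) : Prop :=
  ∀ u ∈ C, ∀ v ∈ C, ∃ p : G.Walk u v, ∀ y ∈ p.support, y ∈ C

theorem Conn.singleton (G : SimpleGraph V) (v : V) : Conn G {v} := by
  rintro u rfl w rfl
  exact ⟨.nil, by simp⟩

theorem Conn.union_adj {G : SimpleGraph V} {C D : Set V} (hC : Conn G C) (hD : Conn G D)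
    {c d : V} (hc : c ∈ C) (hd : d ∈ D) (h : G.Adj c d) : Conn G (C ∪ D) := by
  have key : ∀ u ∈ C, ∀ v ∈ D, ∃ p : G.Walk u v, ∀ y ∈ p.support, y ∈ C ∪ D := by
    intro u hu v hv
    obtain ⟨p, hp⟩ := hC u hu c hc
    obtain ⟨q, hq⟩ := hD d hd v hv
    refine ⟨p.append (.cons h q), ?_⟩
    intro y hy
    rw [Walk.mem_support_append_iff, Walk.support_cons, List.mem_cons] at hy
    rcases hy with hy | rfl | hy
    · exact Or.inl (hp _ hy)
    · exact Or.inl hc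
    · exact Or.inr (hq _ hy)
  rintro u (hu | hu) v (hv | hv)
  · obtain ⟨p, hp⟩ := hC u hu v hv
    exact ⟨p, fun y hy => Or.inl (hp y hy)⟩
  · exact key u hu v hv
  · obtain ⟨p, hp⟩ := key v hv u hu
    exact ⟨p.reverse, fun y hy => hp y (by simpa using hy)⟩
  · obtain ⟨p, hp⟩ := hD u hu v hv
    exact ⟨p, fun y hy => Or.inr (hp y hy)⟩

theorem Conn.union {G : SimpleGraph V} {C D : Set V} (hC : Conn G C) (hD : Conn G D)
    {c : V} (hc : c ∈ C) (hd : c ∈ D) : Conn G (C ∪ D) := by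
  have key : ∀ u ∈ C, ∀ v ∈ D, ∃ p : G.Walk u v, ∀ y ∈ p.support, y ∈ C ∪ D := by
    intro u hu v hv
    obtain ⟨p, hp⟩ := hC u hu c hc
    obtain ⟨q, hq⟩ := hD c hd v hv
    refine ⟨p.append q, ?_⟩
    intro y hy
    rw [Walk.mem_support_append_iff] at hy
    rcases hy with hy | hy
    · exact Or.inl (hp _ hy)
    · exact Or.inr (hq _ hy)
  rintro u (hu | hu) v (hv | hv)
  · obtain ⟨p, hp⟩ := hC u hu v hv
    exact ⟨p, fun y hy => Or.inl (hp y hy)⟩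
  · exact key u hu v hv
  · obtain ⟨p, hp⟩ := key v hv u hu
    exact ⟨p.reverse, fun y hy => hp y (by simpa using hy)⟩
  · obtain ⟨p, hp⟩ := hD u hu v hv
    exact ⟨p, fun y hy => Or.inr (hp y hy)⟩

theorem Conn.mono {G G' : SimpleGraph V} (hG : G ≤ G') {C : Set V} (hC : Conn G C) :
    Conn G' C := by
  intro u hu v hv
  obtain ⟨p, hp⟩ := hC u hu v hv
  exact ⟨p.mapLe hG, by simpa using hp⟩

/-- linkage -/
def Linked (G : SimpleGraph V) (X Z : Finset V) : Prop :=
  ∃ P : V → Set V, (∀ x ∈ bd G X, x ∈ P x ∧ P x ⊆ insert x ((Z : Set V) \ X) ∧ Conn G (P x) ∧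
    ∃ z ∈ bd G Z, z ∈ P x) ∧
    ∀ x ∈ bd G X, ∀ y ∈ bd G X, x ≠ y → Disjoint (P x) (P y)

theorem Linked.trans {G : SimpleGraph V} {X Y Z : Finset V} (hXY : X ⊆ Y) (hYZ : Y ⊆ Z)
    (h1 : Linked G X Y) (h2 : Linked G Y Z) : Linked G X Z := by
  obtain ⟨P, hP, hPd⟩ := h1
  obtain ⟨Q, hQ, hQd⟩ := h2
  have hg : ∀ x, ∃ z, x ∈ bd G X → z ∈ bd G Y ∧ z ∈ P x := by
    intro x
    by_cases hx : x ∈ bd G X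
    · obtain ⟨-, -, -, z, h⟩ := hP x hx
      exact ⟨z, fun _ => h⟩
    · exact ⟨x, fun h => absurd h hx⟩
  choose g hg using hg
  have hPY : ∀ x ∈ bd G X, ∀ y ∈ P x, y ∈ Y := by
    intro x hx y hy
    rcases (hP x hx).2.1 hy with rfl | h
    · exact hXY (mem_bd.1 hx).1
    · exact h.1
  have hdisj : ∀ x ∈ bd G X, ∀ y ∈ bd G X, x ≠ y → Disjoint (P x) (Q (g y)) := by
    intro x hx y hy hne
    rw [Set.disjoint_left]
    intro a ha hb
    rcases (hQ _ (hg y hy).1).2.1 hb with rfl | h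
    · exact Set.disjoint_left.1 (hPd x hx y hy hne) ha (hg y hy).2
    · exact h.2 (hPY x hx a ha)
  refine ⟨fun x => P x ∪ Q (g x), ?_, ?_⟩
  · intro x hx
    obtain ⟨a1, a2, a3, a4⟩ := hP x hx
    obtain ⟨b1, b2, b3, z, hz, hzQ⟩ := hQ _ (hg x hx).1
    refine ⟨Or.inl a1, ?_, a3.union b3 (hg x hx).2 b1, z, hz, Or.inr hzQ⟩
    rintro y (hy | hy)
    · rcases a2 hy with h | h
      · exact Or.inl h
      · exact Or.inr ⟨hYZ h.1, h.2⟩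
    · rcases b2 hy with rfl | h
      · rcases a2 (hg x hx).2 with h | h
        · exact Or.inl h
        · exact Or.inr ⟨hYZ h.1, h.2⟩
      · exact Or.inr ⟨h.1, fun h' => h.2 (hXY h')⟩
  · intro x hx y hy hne
    have hgne : g x ≠ g y := by
      intro h
      have := (hg x hx).2
      rw [h] at this
      exact Set.disjoint_left.1 (hPd x hx y hy hne) this (hg y hy).2
    rw [Set.disjoint_union_left, Set.disjoint_union_right, Set.disjoint_union_right]
    exact ⟨⟨hPd x hx y hy hne, hdisj x hx y hy hne⟩, (hdisj y hy x hx hne.symm).symm,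
      hQd _ (hg x hx).1 _ (hg y hy).1 hgne⟩

theorem linked_aux (N : ℕ) : ∀ (G : SimpleGraph V) (X Z : Finset V),
    G.edgeSet.ncard + (Z \ X).card < N → X ⊆ Z →
    (∀ Y, X ⊆ Y → Y ⊆ Z → (bd G X).card ≤ (bd G Y).card) → Linked G X Z := by
  induction N with
  | zero => intro G X Z h; omega
  | succ N ih =>
    intro G X Z hN hXZ hmin
    by_cases hsub : bd G X ⊆ bd G Z
    · refine ⟨fun x => {x}, fun x hx => ⟨rfl, by simp, Conn.singleton G x, x, hsub hx, rfl⟩, ?_⟩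
      intro x _ y _ hne
      simpa using hne
    obtain ⟨x, hxX, hxZ⟩ := Finset.not_subset.1 hsub
    obtain ⟨hx, v, hvX, hxv⟩ := mem_bd.1 hxX
    have hvZ : v ∈ Z := by
      by_contra h
      exact hxZ (mem_bd.2 ⟨hXZ hx, v, h, hxv⟩)
    -- composition
    have comp : ∀ Y, X ⊆ Y → Y ⊆ Z → Y ≠ X → Linked G X Y → (bd G Y).card ≤ (bd G X).card →
        Linked G X Z := by
      intro Y h1 h2 hne hl hc
      refine hl.trans h1 h2 (ih G Y Z ?_ h2 ?_)
      · have : (Z \ Y).card < (Z \ X).card := by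
          apply Finset.card_lt_card
          refine ⟨Finset.sdiff_subset_sdiff (le_refl _) h1, ?_⟩
          intro hh
          apply hne
          apply Finset.Subset.antisymm _ h1
          intro z hz
          by_contra hzX
          exact (Finset.mem_sdiff.1 (hh (Finset.mem_sdiff.2 ⟨h2 hz, hzX⟩))).2 hz
        omega
      · intro Y' h3 h4
        exact hc.trans (hmin Y' (h1.trans h3) h4)
    let G' := G.deleteEdges {s(x, v)}
    have hle : G' ≤ G := G.deleteEdges_le _
    have hbd : ∀ Y, bd G' Y ⊆ bd G Y := by
      intro Y z hz
      obtain ⟨a, y, b, c⟩ := mem_bd.1 hz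
      exact mem_bd.2 ⟨a, y, b, hle c⟩
    have hcard : G'.edgeSet.ncard < G.edgeSet.ncard := by
      apply Set.ncard_lt_ncard _ (Set.toFinite _)
      refine ⟨SimpleGraph.edgeSet_mono hle, fun hh => ?_⟩
      have := hh ((SimpleGraph.mem_edgeSet G).2 hxv)
      simp [G'] at this
    by_cases hall : ∀ Y, X ⊆ Y → Y ⊆ Z → (bd G X).card ≤ (bd G' Y).card
    · have hX : bd G' X = bd G X :=
        Finset.eq_of_subset_of_card_le (hbd X) (hall X (le_refl _) hXZ)
      obtain ⟨P, hP, hPd⟩ := ih G' X Z (by omega) hXZ (by rw [hX]; exact hall)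
      rw [hX] at hP hPd
      refine ⟨P, fun y hy => ?_, hPd⟩
      obtain ⟨a1, a2, a3, z, hz, a4⟩ := hP y hy
      exact ⟨a1, a2, a3.mono hle, z, hbd Z hz, a4⟩
    · push Not at hall
      obtain ⟨Y, hXY, hYZ, hYc⟩ := hall
      have hxY := hXY hx
      have hera : (bd G Y).erase x ⊆ bd G' Y := by
        intro z hz
        obtain ⟨hzx, hz⟩ := Finset.mem_erase.1 hz
        obtain ⟨hzY, y, hy, ha⟩ := mem_bd.1 hz
        refine mem_bd.2 ⟨hzY, y, hy, ?_⟩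
        simp only [G', SimpleGraph.deleteEdges_adj, Set.mem_singleton_iff, Sym2.eq_iff]
        refine ⟨ha, ?_⟩
        rintro (⟨rfl, _⟩ | ⟨_, rfl⟩)
        · exact hzx rfl
        · exact hy hxY
      have hYmin := hmin Y hXY hYZ
      have hxG' : x ∉ bd G' Y := by
        intro hxG'
        have : bd G Y ⊆ bd G' Y := by
          intro z hz
          by_cases h : z = x
          · rwa [h]
          · exact hera (Finset.mem_erase.2 ⟨h, hz⟩)
        have := Finset.card_le_card this
        omega
      have honly : ∀ y, y ∉ Y → G.Adj x y → y = v := by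
        intro y hy ha
        by_contra hne
        apply hxG'
        refine mem_bd.2 ⟨hxY, y, hy, ?_⟩
        simp only [G', SimpleGraph.deleteEdges_adj, Set.mem_singleton_iff, Sym2.eq_iff]
        refine ⟨ha, ?_⟩
        rintro (⟨_, rfl⟩ | ⟨rfl, rfl⟩)
        · exact hne rfl
        · exact hvX hx
      have hvY : v ∉ Y := by
        intro hvY
        have : bd G Y ⊆ bd G' Y := by
          intro z hz
          by_cases h : z = x
          · subst h
            obtain ⟨_, y, hy, ha⟩ := mem_bd.1 hz
            exact absurd (honly y hy ha ▸ hvY) hy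
          · exact hera (Finset.mem_erase.2 ⟨h, hz⟩)
        have := Finset.card_le_card this
        omega
      by_cases hYX : Y = X
      · subst hYX
        have hvx : v ≠ x := fun h => hvX (h ▸ hx)
        have hs : bd G (insert v Y) ⊆ insert v ((bd G Y).erase x) := by
          intro z hz
          rcases Finset.mem_insert.1 (bd_insert_subset G Y v hz) with rfl | hz'
          · exact Finset.mem_insert_self _ _
          · by_cases h : z = x
            · subst h
              obtain ⟨_, y, hy, ha⟩ := mem_bd.1 hz
              have h2 := honly y (fun h => hy (Finset.mem_insert_of_mem h)) ha
              exact absurd (h2 ▸ Finset.mem_insert_self _ _) hy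
            · exact Finset.mem_insert_of_mem (Finset.mem_erase.2 ⟨h, hz'⟩)
        have hsub' : insert v Y ⊆ Z := Finset.insert_subset hvZ hXZ
        have hc1 : (insert v ((bd G Y).erase x)).card ≤ (bd G Y).card := by
          refine (Finset.card_insert_le _ _).trans ?_
          rw [Finset.card_erase_add_one hxX]
        have heq := Finset.eq_of_subset_of_card_le hs
          (hc1.trans (hmin _ (Finset.subset_insert _ _) hsub'))
        refine comp (insert v Y) (Finset.subset_insert _ _) hsub' ?_ ?_ ?_
        · intro h
          exact hvX (h ▸ Finset.mem_insert_self _ _)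
        · refine ⟨fun w => if w = x then {x} ∪ {v} else {w}, ?_, ?_⟩
          · intro w hw
            by_cases hwx : w = x
            · subst hwx
              simp only [if_true]
              refine ⟨by simp, ?_, (Conn.singleton G w).union_adj (Conn.singleton G v) rfl rfl hxv,
                v, by rw [heq]; simp, by simp⟩
              rintro y (rfl | rfl)
              · exact Or.inl rfl
              · exact Or.inr ⟨by simp, by simpa using hvX⟩
            · simp only [hwx, if_false]
              exact ⟨rfl, by simp, Conn.singleton G w, w, by
                rw [heq]; exact Finset.mem_insert_of_mem (Finset.mem_erase.2 ⟨hwx, hw⟩), rfl⟩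
          · intro w hw w' hw' hne
            have hwv : w ≠ v := fun h => hvX (h ▸ (mem_bd.1 hw).1)
            have hwv' : w' ≠ v := fun h => hvX (h ▸ (mem_bd.1 hw').1)
            rw [Set.disjoint_left]
            intro a
            dsimp only
            split_ifs <;> simp <;> grind
        · rw [heq]; exact hc1
      · have hYc2 : (bd G Y).card ≤ (bd G X).card := by
          have h1 := Finset.card_le_card hera
          have h2 := Finset.pred_card_le_card_erase (s := bd G Y) (a := x)
          omega
        refine comp Y hXY hYZ hYX (ih G X Y ?_ hXY ?_) hYc2
        · have : (Y \ X).card < (Z \ X).card := by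
            apply Finset.card_lt_card
            refine ⟨Finset.sdiff_subset_sdiff hYZ (le_refl _), ?_⟩
            intro hh
            exact hvY (Finset.mem_sdiff.1 (hh (Finset.mem_sdiff.2 ⟨hvZ, hvX⟩))).1
          omega
        · intro Y' h1 h2
          exact hmin Y' h1 (h2.trans hYZ)


structure Grow (G : SimpleGraph V) (n : ℕ) (par : ℕ → ℕ) (m : ℕ) (X : Finset V)
    (B : ℕ → Set V) (b : ℕ → V) : Prop where
  adm : Adm G n X
  card : (bd G X).card ≤ m
  max : ∀ Y, Adm G n Y → X ⊂ Y → m < (bd G Y).card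
  hb : ∀ i < m, b i ∈ bd G X ∧ b i ∈ B i
  sub : ∀ i < m, B i ⊆ (X : Set V)
  conn : ∀ i < m, Conn G (B i)
  disj : ∀ i < m, ∀ j < m, i ≠ j → Disjoint (B i) (B j)
  edge : ∀ i < m, i ≠ 0 → ∃ u ∈ B (par i), ∃ v ∈ B i, G.Adj u v

theorem exists_max (G : SimpleGraph V) (n m : ℕ) (X : Finset V) (hX : Adm G n X)
    (hc : (bd G X).card ≤ m) : ∃ Z, X ⊆ Z ∧ Adm G n Z ∧ (bd G Z).card ≤ m ∧
      ∀ Y, Adm G n Y → Z ⊂ Y → m < (bd G Y).card := by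
  have hne : (Finset.univ.filter
    (fun Z : Finset V => X ⊆ Z ∧ Adm G n Z ∧ (bd G Z).card ≤ m)).Nonempty :=
    ⟨X, by simp [hX, hc]⟩
  obtain ⟨Z, hZ, hmax⟩ := Finset.exists_max_image _ Finset.card hne
  simp only [Finset.mem_filter, Finset.mem_univ, true_and] at hZ hmax
  refine ⟨Z, hZ.1, hZ.2.1, hZ.2.2, fun Y hY hZY => ?_⟩
  by_contra h
  have := hmax Y ⟨hZ.1.trans hZY.1, hY, by omega⟩
  have := Finset.card_lt_card hZY
  omega

theorem grow (G : SimpleGraph V) (n : ℕ) (par : ℕ → ℕ) (hpar : ∀ i, i ≠ 0 → par i < i)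
    (hV : ¬ Adm G n Finset.univ) : ∀ m ≤ n, ∃ X B b, Grow G n par m X B b := by
  intro m
  induction m with
  | zero =>
    intro _
    obtain ⟨Z, h0, h1, h2, h3⟩ := exists_max G n 0 ∅ Adm.empty (by simp [bd])
    have hne : Z ≠ Finset.univ := fun h => hV (h ▸ h1)
    have : ∃ v, v ∉ Z := by
      by_contra h
      push Not at h
      exact hne (Finset.eq_univ_iff_forall.2 h)
    obtain ⟨v, hv⟩ := this
    exact ⟨Z, fun _ => ∅, fun _ => v, h1, h2, h3, by simp, by simp, by simp, by simp, by simp⟩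
  | succ m ih =>
    intro hm
    obtain ⟨X, B, b, hG⟩ := ih (by omega)
    have hv : ∃ v, v ∉ X ∧ (m ≠ 0 → G.Adj (b (par m)) v) := by
      by_cases h0 : m = 0
      · by_contra h
        push Not at h
        have hu : X = Finset.univ := by
          rw [Finset.eq_univ_iff_forall]
          intro v
          by_contra hv
          exact (h v hv).1 h0
        exact hV (hu ▸ hG.adm)
      · obtain ⟨v, hv, ha⟩ := (mem_bd.1 (hG.hb _ (hpar m h0)).1).2
        exact ⟨v, hv, fun _ => ha⟩
    obtain ⟨v, hv, hva⟩ := hv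
    have hXX' : X ⊂ insert v X := Finset.ssubset_insert hv
    have hcard := hG.card
    have hX' : Adm G n (insert v X) := Adm.step _ _ hG.adm (by omega)
    have hgt := hG.max _ hX' hXX'
    have hc2 : (insert v (bd G X)).card ≤ m + 1 :=
      (Finset.card_insert_le _ _).trans (by omega)
    have heq := Finset.eq_of_subset_of_card_le (bd_insert_subset G X v) (by omega)
    obtain ⟨Z, h1, h2, h3, h4⟩ := exists_max G n (m+1) _ hX' (by rw [heq]; exact hc2)
    have hL : Linked G (insert v X) Z := by
      refine linked_aux _ G _ Z (Nat.lt_succ_self _) h1 ?_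
      intro Y hY1 hY2
      rw [heq]
      refine hc2.trans ?_
      by_contra hlt
      have hne : (Finset.univ.filter
        (fun Y : Finset V => insert v X ⊆ Y ∧ Y ⊆ Z)).Nonempty := ⟨Y, by simp [hY1, hY2]⟩
      obtain ⟨Y0, hY0, hmin⟩ := Finset.exists_min_image _ (fun Y => (bd G Y).card) hne
      simp only [Finset.mem_filter, Finset.mem_univ, true_and] at hY0 hmin
      have hY0c := hmin Y ⟨hY1, hY2⟩
      have hadm : Adm G n (Z ∩ Y0) := by
        apply h2.inter
        intro Y' h5 h6
        apply hmin
        exact ⟨hY0.1.trans h5, by rwa [Finset.union_eq_left.2 hY0.2] at h6⟩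
      rw [Finset.inter_eq_right.2 hY0.2] at hadm
      have := hG.max Y0 hadm (hXX'.trans_subset hY0.1)
      omega
    obtain ⟨P, hP, hPd⟩ := hL
    rw [heq] at hP hPd
    have hvb : v ∈ insert v (bd G X) := Finset.mem_insert_self _ _
    have hbb : ∀ i < m, b i ∈ insert v (bd G X) := fun i hi =>
      Finset.mem_insert_of_mem (hG.hb i hi).1
    have hex : ∀ x, ∃ z, x ∈ insert v (bd G X) → z ∈ bd G Z ∧ z ∈ P x := by
      intro x
      by_cases hx : x ∈ insert v (bd G X)
      · obtain ⟨-, -, -, z, h⟩ := hP x hx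
        exact ⟨z, fun _ => h⟩
      · exact ⟨x, fun h => absurd h hx⟩
    choose g hg using hex
    have hbX : ∀ i < m, b i ∈ X := fun i hi => (mem_bd.1 (hG.hb i hi).1).1
    have hBP : ∀ i < m, ∀ x ∈ insert v (bd G X), (x ∈ X → x ∉ B i) → Disjoint (B i) (P x) := by
      intro i hi x hx hxB
      rw [Set.disjoint_left]
      intro a ha haP
      have haX : a ∈ X := hG.sub i hi ha
      rcases (hP x hx).2.1 haP with rfl | h
      · exact hxB haX ha
      · exact h.2 (by simp [haX])
    have hbne : ∀ i < m, ∀ j < m, i ≠ j → b j ∉ B i := fun i hi j hj hne h =>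
      Set.disjoint_left.1 (hG.disj i hi j hj hne) h (hG.hb j hj).2
    have hPZ : ∀ x ∈ insert v (bd G X), P x ⊆ (Z : Set V) := by
      intro x hx a ha
      rcases (hP x hx).2.1 ha with rfl | h
      · rcases Finset.mem_insert.1 hx with rfl | hx
        · exact h1 (Finset.mem_insert_self _ _)
        · exact h1 (Finset.mem_insert_of_mem (mem_bd.1 hx).1)
      · exact h.1
    let B' : ℕ → Set V := fun i => if i < m then B i ∪ P (b i) else P v
    have hB'1 : ∀ i < m, B' i = B i ∪ P (b i) := fun i hi => by simp [B', hi]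
    have hB'2 : B' m = P v := by simp [B']
    refine ⟨Z, B', fun i => if i < m then g (b i) else g v, h2, h3, h4, ?_, ?_, ?_, ?_, ?_⟩
    · intro i hi
      by_cases him : i < m
      · simp only [him, if_true]
        rw [hB'1 i him]
        exact ⟨(hg _ (hbb i him)).1, Or.inr (hg _ (hbb i him)).2⟩
      · obtain rfl : i = m := by omega
        simp only [lt_irrefl, if_false]
        rw [hB'2]
        exact hg _ hvb
    · intro i hi
      by_cases him : i < m
      · rw [hB'1 i him]
        exact Set.union_subset (fun a ha => h1 (Finset.mem_insert_of_mem (hG.sub i him ha)))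
          (hPZ _ (hbb i him))
      · obtain rfl : i = m := by omega
        rw [hB'2]
        exact hPZ _ hvb
    · intro i hi
      by_cases him : i < m
      · rw [hB'1 i him]
        exact (hG.conn i him).union (hP _ (hbb i him)).2.2.1 (hG.hb i him).2 (hP _ (hbb i him)).1
      · obtain rfl : i = m := by omega
        rw [hB'2]
        exact (hP _ hvb).2.2.1
    · have hlast : ∀ i < m, Disjoint (B' i) (B' m) := by
        intro i hi
        rw [hB'1 i hi, hB'2, Set.disjoint_union_left]
        exact ⟨hBP i hi v hvb (fun h => absurd h hv), hPd _ (hbb i hi) _ hvb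
          (fun h => hv (h ▸ hbX i hi))⟩
      intro i hi j hj hne
      by_cases him : i < m
      · by_cases hjm : j < m
        · rw [hB'1 i him, hB'1 j hjm, Set.disjoint_union_left, Set.disjoint_union_right,
            Set.disjoint_union_right]
          exact ⟨⟨hG.disj i him j hjm hne, hBP i him _ (hbb j hjm) (fun _ => hbne i him j hjm hne)⟩,
            (hBP j hjm _ (hbb i him) (fun _ => hbne j hjm i him hne.symm)).symm,
            hPd _ (hbb i him) _ (hbb j hjm)
              (fun h => hbne i him j hjm hne (h ▸ (hG.hb i him).2))⟩
        · obtain rfl : j = m := by omega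
          exact hlast i him
      · obtain rfl : i = m := by omega
        exact (hlast j (by omega)).symm
    · intro i hi h0
      by_cases him : i < m
      · obtain ⟨u, hu, w, hw, ha⟩ := hG.edge i him h0
        exact ⟨u, by rw [hB'1 _ ((hpar i h0).trans him)]; exact Or.inl hu, w,
          by rw [hB'1 i him]; exact Or.inl hw, ha⟩
      · obtain rfl : i = m := by omega
        exact ⟨b (par i), by rw [hB'1 _ (hpar i h0)]; exact Or.inl (hG.hb _ (hpar i h0)).2, v,
          by rw [hB'2]; exact (hP _ hvb).1, hva h0⟩

def enc : List Bool → ℕ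
  | [] => 0
  | x :: l => 2 * enc l + 1 + x.toNat

theorem enc_inj : ∀ l l' : List Bool, enc l = enc l' → l = l' := by
  intro l
  induction l with
  | nil =>
    intro l' h
    cases l' with
    | nil => rfl
    | cons x l' => simp only [enc] at h; omega
  | cons x l ih =>
    intro l' h
    cases l' with
    | nil => simp [enc] at h
    | cons y l' =>
      simp only [enc] at h
      have hx := Bool.toNat_le x
      have hy := Bool.toNat_le y
      have h1 : enc l = enc l' := by omega
      have h2 : x.toNat = y.toNat := by omega
      have h3 : x = y := by revert h2; cases x <;> cases y <;> simp
      rw [ih l' h1, h3]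

theorem enc_lt (l : List Bool) : enc l + 1 < 2 ^ (l.length + 1) := by
  induction l with
  | nil => simp [enc]
  | cons x l ih =>
    have hx := Bool.toNat_le x
    simp only [enc, List.length_cons]
    rw [pow_succ]
    omega

/-- A minor model of the binary tree. -/
structure Model (G : SimpleGraph V) (d : ℕ) (B : List Bool → Set V) : Prop where
  ne : ∀ l, l.length < d → (B l).Nonempty
  conn : ∀ l, l.length < d → Conn G (B l)
  disj : ∀ l l', l.length < d → l'.length < d → l ≠ l' → Disjoint (B l) (B l')
  edge : ∀ l x, l.length + 1 < d → ∃ u ∈ B l, ∃ v ∈ B (x :: l), G.Adj u v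

theorem exists_model (G : SimpleGraph V) (d : ℕ) (hV : ¬ Adm G (2 ^ d) Finset.univ) :
    ∃ B, Model G d B := by
  obtain ⟨X, B, b, h⟩ := grow G (2 ^ d) (fun i => (i - 1) / 2) (fun i hi => by omega)
    hV _ le_rfl
  have hlt : ∀ l : List Bool, l.length < d → enc l < 2 ^ d := by
    intro l hl
    have h1 := enc_lt l
    have h2 : 2 ^ (l.length + 1) ≤ 2 ^ d := Nat.pow_le_pow_right (by norm_num) hl
    omega
  refine ⟨fun l => B (enc l), fun l hl => ⟨_, (h.hb _ (hlt l hl)).2⟩,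
    fun l hl => h.conn _ (hlt l hl),
    fun l l' hl hl' hne => h.disj _ (hlt l hl) _ (hlt l' hl') (fun h => hne (enc_inj _ _ h)), ?_⟩
  intro l x hl
  obtain ⟨u, hu, v, hv, ha⟩ := h.edge (enc (x :: l)) (hlt _ (by simpa using hl)) (by simp [enc])
  have : (enc (x :: l) - 1) / 2 = enc l := by
    have hx := Bool.toNat_le x
    simp only [enc]; omega
  rw [this] at hu
  exact ⟨u, hu, v, hv, ha⟩

theorem first_hit {G : SimpleGraph V} (S : Set V) {u v : V} (q : G.Walk u v) (hv : v ∈ S) :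
    ∃ z ∈ S, ∃ r : G.Walk u z, r.IsPath ∧ (∀ y ∈ r.support, y ∈ q.support) ∧
      ∀ y ∈ r.support, y ∈ S → y = z := by
  induction q with
  | nil => exact ⟨_, hv, .nil, by simp, by simp, by simp⟩
  | @cons a b c h q ih =>
    by_cases ha : a ∈ S
    · exact ⟨a, ha, .nil, by simp, by simp, by simp⟩
    · obtain ⟨z, hz, r, -, h2, h3⟩ := ih hv
      refine ⟨z, hz, (Walk.cons h r).bypass, Walk.bypass_isPath _, ?_, ?_⟩
      · intro y hy
        have := Walk.support_bypass_subset_support _ hy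
        rw [Walk.support_cons, List.mem_cons] at this ⊢
        exact this.imp id (h2 y)
      · intro y hy hyS
        have := Walk.support_bypass_subset_support _ hy
        rw [Walk.support_cons, List.mem_cons] at this
        rcases this with rfl | h
        · exact absurd hyS ha
        · exact h3 y h hyS

/-- tripod lemma -/
theorem tripod {G : SimpleGraph V} {B : Set V} (hB : Conn G B) (t : Option Bool → V)
    (ht : ∀ o, t o ∈ B) : ∃ z ∈ B, ∃ p : ∀ o, G.Walk z (t o), (∀ o, (p o).IsPath) ∧
      (∀ o, ∀ y ∈ (p o).support, y ∈ B) ∧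
      ∀ o o', o ≠ o' → ∀ y ∈ (p o).support, y ∈ (p o').support → y = z := by
  obtain ⟨p', hp'⟩ := hB _ (ht none) _ (ht (some false))
  obtain ⟨p, hpp, hp⟩ : ∃ p : G.Walk (t none) (t (some false)), p.IsPath ∧
      ∀ y ∈ p.support, y ∈ B :=
    ⟨p'.bypass, p'.bypass_isPath, fun y hy => hp' y (p'.support_bypass_subset_support hy)⟩
  obtain ⟨q, hq⟩ := hB _ (ht (some true)) _ (ht none)
  obtain ⟨z, hz, r, hr, hrq, hrS⟩ := first_hit {y | y ∈ p.support} q (by simp)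
  have hz' : z ∈ p.support := hz
  have h01 : ∀ y ∈ (p.takeUntil z hz').reverse.support, y ∈ (p.dropUntil z hz').support →
      y = z := by
    intro y h1 h2
    rw [Walk.support_reverse, List.mem_reverse] at h1
    have hnd := hpp.support_nodup
    rw [← p.take_spec hz', Walk.support_append, List.nodup_append] at hnd
    rw [Walk.mem_support_iff] at h2
    rcases h2 with h2 | h2
    · exact h2
    · exact absurd rfl (hnd.2.2 y h1 y h2)
  have hs0 : ∀ y ∈ (p.takeUntil z hz').reverse.support, y ∈ p.support := by
    intro y h1
    rw [Walk.support_reverse, List.mem_reverse] at h1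
    exact p.support_takeUntil_subset_support hz' h1
  have hs1 : ∀ y ∈ (p.dropUntil z hz').support, y ∈ p.support := fun y h1 =>
    p.support_dropUntil_subset_support hz' h1
  have hs2 : ∀ y ∈ r.reverse.support, y ∈ r.support := by
    intro y h1
    rwa [Walk.support_reverse, List.mem_reverse] at h1
  refine ⟨z, hp z hz, fun o => match o with
    | none => (p.takeUntil z hz').reverse
    | some false => p.dropUntil z hz'
    | some true => r.reverse, ?_, ?_, ?_⟩
  · rintro (_ | _ | _)
    · exact (hpp.takeUntil hz').reverse
    · exact hpp.dropUntil hz'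
    · exact hr.reverse
  · rintro (_ | _ | _) y hy
    · exact hp y (hs0 y hy)
    · exact hp y (hs1 y hy)
    · exact hq y (hrq y (hs2 y hy))
  · rintro (_ | _ | _) (_ | _ | _) hne y h1 h2
    · exact absurd rfl hne
    · exact h01 y h1 h2
    · exact hrS y (hs2 y h2) (hs0 y h1)
    · exact h01 y h2 h1
    · exact absurd rfl hne
    · exact hrS y (hs2 y h2) (hs1 y h1)
    · exact hrS y (hs2 y h1) (hs0 y h2)
    · exact hrS y (hs2 y h1) (hs1 y h2)
    · exact absurd rfl hne

theorem Model.hasSubdivision {G : SimpleGraph V} {d : ℕ} (hd : 0 < d) {B : List Bool → Set V}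
    (hM : Model G d B) : HasSubdivision G (binTree d) := by
  obtain ⟨u0, hu0⟩ := hM.ne [] (by simpa using hd)
  have hE : ∀ l x, ∃ u v, l.length + 1 < d → u ∈ B l ∧ v ∈ B (x :: l) ∧ G.Adj u v := by
    intro l x
    by_cases h : l.length + 1 < d
    · obtain ⟨u, hu, v, hv, ha⟩ := hM.edge l x h
      exact ⟨u, v, fun _ => ⟨hu, hv, ha⟩⟩
    · exact ⟨u0, u0, fun h' => absurd h' h⟩
  choose eu ev hE using hE
  have hc : ∀ l, ∃ c, l.length < d → c ∈ B l := by
    intro l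
    by_cases h : l.length < d
    · obtain ⟨c, hc⟩ := hM.ne l h
      exact ⟨c, fun _ => hc⟩
    · exact ⟨u0, fun h' => absurd h' h⟩
  choose c hc using hc
  have ht : ∀ l : {l : List Bool // l.length < d}, ∃ t : Option Bool → V, (∀ o, t o ∈ B l.1) ∧
      (∀ x, l.1.length + 1 < d → t (some x) = eu l.1 x) ∧
      (∀ x l', l.1 = x :: l' → t none = ev l' x) := by
    rintro ⟨l, hl⟩
    refine ⟨fun o => match o with
      | none => (match l with
        | [] => u0
        | x :: l' => ev l' x)
      | some x => if l.length + 1 < d then eu l x else c l, ?_, ?_, ?_⟩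
    · rintro (_ | x)
      · cases l with
        | nil => exact hu0
        | cons x l' => exact (hE l' x (by simpa using hl)).2.1
      · dsimp only
        split_ifs with h
        · exact (hE l x h).1
        · exact hc l hl
    · intro x h
      exact if_pos h
    · rintro x l' h
      dsimp only at h
      subst h
      rfl
  choose t ht1 ht2 ht3 using ht
  have htri := fun l : {l : List Bool // l.length < d} => tripod (hM.conn l.1 l.2) (t l) (ht1 l)
  choose z hz p hp1 hp2 hp3 using htri
  have hBeq : ∀ (a b : {l : List Bool // l.length < d}) (y : V), y ∈ B a.1 → y ∈ B b.1 → a = b := by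
    intro a b y h1 h2
    by_contra hne
    exact Set.disjoint_left.1 (hM.disj a.1 b.1 a.2 b.2 (fun h => hne (Subtype.ext h))) h1 h2
  have hw : ∀ (a b : {l : List Bool // l.length < d}) (x : Bool), b.1 = x :: a.1 →
      ∃ w : G.Walk (z a) (z b), w.IsPath ∧ 1 ≤ w.length ∧
        ∀ y ∈ w.support, y ∈ (p a (some x)).support ∨ y ∈ (p b none).support := by
    intro a b x hab
    have hlen : a.1.length + 1 < d := by
      have := b.2
      rw [hab] at this
      simpa using this
    have hadj : G.Adj (t a (some x)) (t b none) := by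
      rw [ht2 a x hlen, ht3 b x a.1 hab]
      exact (hE a.1 x hlen).2.2
    have hne : a ≠ b := by
      rintro rfl
      have := congrArg List.length hab
      simp at this
    refine ⟨(p a (some x)).append (.cons hadj (p b none).reverse), ?_, ?_, ?_⟩
    · rw [Walk.isPath_def, Walk.support_append, List.nodup_append]
      refine ⟨(hp1 a _).support_nodup, ?_, ?_⟩
      · simpa using (hp1 b none).support_nodup
      · rintro y h1 y' h2 rfl
        simp only [Walk.support_cons, List.tail_cons, Walk.support_reverse, List.mem_reverse] at h2
        exact hne (hBeq a b y (hp2 _ _ _ h1) (hp2 _ _ _ h2))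
    · simp only [Walk.length_append, Walk.length_cons]; omega
    · intro y hy
      simp only [Walk.mem_support_append_iff, Walk.support_cons, Walk.support_reverse,
        List.mem_cons, List.mem_reverse] at hy
      rcases hy with h | rfl | h
      · exact Or.inl h
      · exact Or.inl (Walk.end_mem_support _)
      · exact Or.inr h
  have hP : ∀ (a b : {l : List Bool // l.length < d}), (binTree d).Adj a b →
      ∃ w : G.Walk (z a) (z b), w.IsPath ∧ 1 ≤ w.length ∧
        ∃ (e f : {l : List Bool // l.length < d}) (x : Bool), f.1 = x :: e.1 ∧ s(a, b) = s(e, f) ∧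
          ∀ y ∈ w.support, y ∈ (p e (some x)).support ∨ y ∈ (p f none).support := by
    intro a b hab
    rw [binTree, SimpleGraph.fromRel_adj] at hab
    rcases hab with ⟨-, ⟨x, h⟩ | ⟨x, h⟩⟩
    · obtain ⟨w, h1, h2, h3⟩ := hw a b x h
      exact ⟨w, h1, h2, a, b, x, h, rfl, h3⟩
    · obtain ⟨w, h1, h2, h3⟩ := hw b a x h
      exact ⟨w.reverse, h1.reverse, by simpa using h2, b, a, x, h, Sym2.eq_swap,
        fun y hy => h3 y (by simpa using hy)⟩
  choose P hP1 hP2 e f x hP3 hP4 hP5 using hP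
  refine ⟨z, P, ?_, hP1, hP2, ?_, ?_⟩
  · intro a b hab
    exact hBeq a b (z a) (hz a) (hab ▸ hz b)
  · rintro a b h y hy ⟨c', rfl⟩
    have key : c' = e a b h ∨ c' = f a b h := by
      rcases hP5 a b h _ hy with h' | h'
      · exact Or.inl (hBeq _ _ _ (hz _) (hp2 _ _ _ h'))
      · exact Or.inr (hBeq _ _ _ (hz _) (hp2 _ _ _ h'))
    have h4 := hP4 a b h
    rw [Sym2.eq_iff] at h4
    rcases key with rfl | rfl <;> rcases h4 with ⟨h5, h6⟩ | ⟨h5, h6⟩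
    · exact Or.inl (congrArg z h5.symm)
    · exact Or.inr (congrArg z h6.symm)
    · exact Or.inr (congrArg z h6.symm)
    · exact Or.inl (congrArg z h5.symm)
  · intro a b a' b' h h' hne y hy hy'
    rw [hP4 a b h, hP4 a' b' h'] at hne
    have h3 := hP3 a b h
    have h3' := hP3 a' b' h'
    have gen : ∀ m m' o o', y ∈ (p m o).support → y ∈ (p m' o').support → (m = m' → o ≠ o') →
        y ∈ Set.range z := by
      intro m m' o o' k1 k2 k3
      obtain rfl : m = m' := hBeq _ _ y (hp2 _ _ _ k1) (hp2 _ _ _ k2)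
      exact ⟨m, (hp3 m o o' (k3 rfl) y k1 k2).symm⟩
    rcases hP5 a b h y hy with k | k <;> rcases hP5 a' b' h' y hy' with k' | k'
    · refine gen _ _ _ _ k k' (fun hm ho => hne ?_)
      have hx : x a b h = x a' b' h' := Option.some.inj ho
      have hf : f a b h = f a' b' h' := Subtype.ext (by rw [h3, h3', hx, hm])
      rw [hm, hf]
    · exact gen _ _ _ _ k k' (fun _ => by simp)
    · exact gen _ _ _ _ k k' (fun _ => by simp)
    · refine gen _ _ _ _ k k' (fun hm _ => hne ?_)
      have : e a b h = e a' b' h' := by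
        rw [hm, h3'] at h3
        exact Subtype.ext (List.cons.inj h3).2.symm
      rw [hm, this]

theorem conn_support {G : SimpleGraph V} {u v : V} (p : G.Walk u v) :
    Conn G {y | y ∈ p.support} := by
  intro a ha b hb
  refine ⟨(p.takeUntil a ha).reverse.append (p.takeUntil b hb), ?_⟩
  intro y hy
  rw [Walk.mem_support_append_iff, Walk.support_reverse, List.mem_reverse] at hy
  rcases hy with h | h
  · exact p.support_takeUntil_subset_support ha h
  · exact p.support_takeUntil_subset_support hb h

theorem exists_cons {G : SimpleGraph V} {u v : V} (p : G.Walk u v) (h : 1 ≤ p.length) :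
    ∃ (w : V) (ha : G.Adj u w) (q : G.Walk w v), p = .cons ha q := by
  cases p with
  | nil => simp at h
  | cons ha q => exact ⟨_, ha, q, rfl⟩

theorem HasSubdivision.model {G : SimpleGraph V} {d : ℕ} (hS : HasSubdivision G (binTree d)) :
    ∃ B, Model G d B := by
  obtain ⟨f, P, hinj, hpath, hlen, hr, hdj⟩ := hS
  have hadj : ∀ (l : List Bool) (x : Bool) (h : (x :: l).length < d),
      (binTree d).Adj ⟨l, by simp at h; omega⟩ ⟨x :: l, h⟩ := by
    intro l x h
    rw [binTree, SimpleGraph.fromRel_adj]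
    refine ⟨?_, Or.inl ⟨x, rfl⟩⟩
    intro h
    have := congrArg (fun a => a.1.length) h
    simp at this
  -- the sets
  have hB : ∀ l : List Bool, ∃ S : Set V, ∀ h : l.length < d, f ⟨l, h⟩ ∈ S ∧ Conn G S ∧
      (∀ y ∈ S, y ∈ Set.range f → y = f ⟨l, h⟩) ∧
      ((l = [] ∧ S = {f ⟨l, h⟩}) ∨ ∃ x l', ∃ e : l = x :: l',
        (∃ v ∈ S, G.Adj (f ⟨l', by subst e; simp at h; omega⟩) v) ∧
        ∀ y ∈ S, y ∈ (P (hadj l' x (e ▸ h))).support) := by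
    intro l
    by_cases h : l.length < d
    swap
    · exact ⟨∅, fun h' => absurd h' h⟩
    cases l with
    | nil =>
      exact ⟨{f ⟨[], h⟩}, fun _ => ⟨rfl, Conn.singleton G _, fun y hy _ => hy, Or.inl ⟨rfl, rfl⟩⟩⟩
    | cons x l =>
      have h1 := hpath _ _ (hadj l x h)
      have h2 := hr _ _ (hadj l x h)
      have h3 := hlen _ _ (hadj l x h)
      · obtain ⟨w, ha, q, hw⟩ := exists_cons (P (hadj l x h)) h3
        rw [hw] at h1 h2
        rw [Walk.cons_isPath_iff] at h1
        refine ⟨{y | y ∈ q.support}, fun _ => ⟨q.end_mem_support, conn_support q, ?_, Or.inr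
          ⟨x, l, rfl, ⟨_, q.start_mem_support, ha⟩, ?_⟩⟩⟩
        · intro y hy hyr
          rcases h2 y (List.mem_cons_of_mem _ hy) hyr with rfl | h
          · exact absurd hy h1.2
          · exact h
        · intro y hy
          rw [hw]
          exact List.mem_cons_of_mem _ hy
  choose B hB using hB
  refine ⟨B, fun l h => ⟨_, (hB l h).1⟩, fun l h => (hB l h).2.1, ?_, ?_⟩
  · intro l l' hl hl' hne
    rw [Set.disjoint_left]
    intro y hy hy'
    obtain ⟨-, -, h3, h4⟩ := hB l hl
    obtain ⟨-, -, h3', h4'⟩ := hB l' hl'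
    have hyr : y ∈ Set.range f := by
      rcases h4 with ⟨rfl, h4⟩ | ⟨x, m, rfl, -, h4⟩
      · rw [h4] at hy
        exact ⟨_, hy.symm⟩
      · rcases h4' with ⟨rfl, h4'⟩ | ⟨x', m', rfl, -, h4'⟩
        · rw [h4'] at hy'
          exact ⟨_, hy'.symm⟩
        · refine hdj _ _ _ _ (hadj m x hl) (hadj m' x' hl') ?_ y (h4 y hy) (h4' y hy')
          intro hs
          rw [Sym2.eq_iff] at hs
          simp only [Subtype.mk.injEq] at hs
          rcases hs with ⟨h5, h6⟩ | ⟨h5, h6⟩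
          · exact hne h6
          · have e1 := congrArg List.length h5
            have e2 := congrArg List.length h6
            simp at e1 e2
            omega
    have e := (h3 y hy hyr).symm.trans (h3' y hy' hyr)
    exact hne (congrArg Subtype.val (hinj e))
  · intro l x hl
    obtain ⟨-, -, -, h4⟩ := hB (x :: l) (by simpa using hl)
    rcases h4 with ⟨h4, -⟩ | ⟨x', l', e, ⟨v, hv, ha⟩, -⟩
    · simp at h4
    · obtain ⟨rfl, rfl⟩ := List.cons.inj e
      exact ⟨_, (hB l (by omega)).1, v, hv, ha⟩

theorem hits {G : SimpleGraph V} {n : ℕ} {W : Fin n → Finset V}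
    (hE : ∀ u v : V, G.Adj u v → ∃ i, u ∈ W i ∧ v ∈ W i)
    (hI : ∀ i j l : Fin n, i ≤ j → j ≤ l → ∀ v : V, v ∈ W i → v ∈ W l → v ∈ W j)
    {u v : V} (p : G.Walk u v) (j l : Fin n) (hjl : j ≤ l) (hv : v ∈ W l) :
    ∀ i, i ≤ j → u ∈ W i → ∃ y ∈ p.support, y ∈ W j := by
  induction p with
  | nil => intro i hij hu; exact ⟨_, by simp, hI i j l hij hjl _ hu hv⟩
  | @cons a b c h q ih =>
    intro i hij hu
    obtain ⟨t, h1, h2⟩ := hE _ _ h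
    rcases le_total t j with htj | htj
    · obtain ⟨y, hy, hyW⟩ := ih hv t htj h2
      exact ⟨y, by simp [hy], hyW⟩
    · exact ⟨a, by simp, hI i j t hij htj _ hu h1⟩

def subT (B : List Bool → Set V) : ℕ → List Bool → Set V
  | 0, _ => ∅
  | h + 1, l => B l ∪ subT B h (false :: l) ∪ subT B h (true :: l)

theorem subT_mem {B : List Bool → Set V} (h : ℕ) : ∀ (l : List Bool) (y : V), y ∈ subT B h l →
    ∃ m : List Bool, m.length < h ∧ y ∈ B (m ++ l) := by
  induction h with
  | zero => intro l y hy; exact hy.elim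
  | succ h ih =>
    rintro l y ((hy | hy) | hy)
    · exact ⟨[], by simp, hy⟩
    · obtain ⟨m, h1, h2⟩ := ih _ y hy
      exact ⟨m ++ [false], by simpa using h1, by simpa using h2⟩
    · obtain ⟨m, h1, h2⟩ := ih _ y hy
      exact ⟨m ++ [true], by simpa using h1, by simpa using h2⟩

theorem subT_conn {G : SimpleGraph V} {d : ℕ} {B : List Bool → Set V} (hM : Model G d B) (h : ℕ) :
    ∀ l : List Bool, l.length + h ≤ d → Conn G (subT B h l) ∧ (0 < h → B l ⊆ subT B h l) := by
  induction h with
  | zero => intro l _; exact ⟨fun u hu => hu.elim, by simp⟩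
  | succ h ih =>
    intro l hl
    refine ⟨?_, fun _ y hy => Or.inl (Or.inl hy)⟩
    rcases Nat.eq_zero_or_pos h with rfl | hpos
    · simpa [subT] using hM.conn l (by omega)
    · obtain ⟨c1, s1⟩ := ih (false :: l) (by simp; omega)
      obtain ⟨c2, s2⟩ := ih (true :: l) (by simp; omega)
      obtain ⟨u1, hu1, v1, hv1, a1⟩ := hM.edge l false (by omega)
      obtain ⟨u2, hu2, v2, hv2, a2⟩ := hM.edge l true (by omega)
      exact ((hM.conn l (by omega)).union_adj c1 hu1 (s1 hpos hv1) a1).union_adj c2 (Or.inl hu2)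
        (s2 hpos hv2) a2

/-- the three-branches step -/
theorem three {G : SimpleGraph V} {n : ℕ} {W : Fin n → Finset V}
    (hE : ∀ u v : V, G.Adj u v → ∃ i, u ∈ W i ∧ v ∈ W i)
    (hI : ∀ i j l : Fin n, i ≤ j → j ≤ l → ∀ v : V, v ∈ W i → v ∈ W l → v ∈ W j)
    (K T : Set V) (S : Fin 3 → Set V)
    (hconn : ∀ a b, Conn G (S a ∪ K ∪ S b)) (hK : ∀ a, Disjoint K (S a))
    (hS : ∀ a b, a ≠ b → Disjoint (S a) (S b)) (hT : ∀ a, S a ⊆ T) (hKT : K ⊆ T)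
    (h : ℕ) (hi : ∀ a, ∃ i, h + 1 ≤ 2 * ((W i).filter (· ∈ S a)).card) :
    ∃ i, h + 3 ≤ 2 * ((W i).filter (· ∈ T)).card := by
  choose i hi using hi
  have main : ∀ a b c : Fin 3, a ≠ b → b ≠ c → i a ≤ i b → i b ≤ i c →
      ∃ i, h + 3 ≤ 2 * ((W i).filter (· ∈ T)).card := by
    intro a b c hab hbc h1 h2
    have hne : ∀ a, ∃ y ∈ W (i a), y ∈ S a := by
      intro a
      have : 0 < ((W (i a)).filter (· ∈ S a)).card := by have := hi a; omega
      obtain ⟨y, hy⟩ := Finset.card_pos.1 this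
      exact ⟨y, (Finset.mem_filter.1 hy).1, (Finset.mem_filter.1 hy).2⟩
    obtain ⟨u, hu, huS⟩ := hne a
    obtain ⟨v, hv, hvS⟩ := hne c
    obtain ⟨p, hp⟩ := hconn a c u (Or.inl (Or.inl huS)) v (Or.inr hvS)
    obtain ⟨y, hy, hyW⟩ := hits hE hI p (i b) (i c) h2 hv (i a) h1 hu
    have hyC := hp y hy
    have hyb : y ∉ S b := by
      intro hyb
      rcases hyC with (h | h) | h
      · exact Set.disjoint_left.1 (hS a b hab) h hyb
      · exact Set.disjoint_left.1 (hK b) h hyb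
      · exact Set.disjoint_left.1 (hS b c hbc) hyb h
    have hyT : y ∈ T := by
      rcases hyC with (h | h) | h
      · exact hT a h
      · exact hKT h
      · exact hT c h
    refine ⟨i b, ?_⟩
    have hsub : insert y ((W (i b)).filter (· ∈ S b)) ⊆ (W (i b)).filter (· ∈ T) := by
      intro w hw
      rcases Finset.mem_insert.1 hw with rfl | hw
      · exact Finset.mem_filter.2 ⟨hyW, hyT⟩
      · exact Finset.mem_filter.2 ⟨(Finset.mem_filter.1 hw).1, hT b (Finset.mem_filter.1 hw).2⟩
    have hc := Finset.card_le_card hsub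
    have e := Finset.card_insert_of_notMem (s := (W (i b)).filter (· ∈ S b)) (a := y)
      (fun h => hyb (Finset.mem_filter.1 h).2)
    have := hi b
    omega
  rcases le_total (i 0) (i 1) with h01 | h01 <;> rcases le_total (i 1) (i 2) with h12 | h12 <;>
    rcases le_total (i 0) (i 2) with h02 | h02
  · exact main 0 1 2 (by decide) (by decide) h01 h12
  · exact main 0 1 2 (by decide) (by decide) h01 h12
  · exact main 0 2 1 (by decide) (by decide) h02 h12
  · exact main 2 0 1 (by decide) (by decide) h02 h01
  · exact main 1 0 2 (by decide) (by decide) h01 h02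
  · exact main 1 2 0 (by decide) (by decide) h12 h02
  · exact main 2 1 0 (by decide) (by decide) h12 h01
  · exact main 2 1 0 (by decide) (by decide) h12 h01

theorem lower {G : SimpleGraph V} {n d : ℕ} {W : Fin n → Finset V} {B : List Bool → Set V}
    (hM : Model G d B) (hV : ∀ v : V, ∃ i, v ∈ W i)
    (hE : ∀ u v : V, G.Adj u v → ∃ i, u ∈ W i ∧ v ∈ W i)
    (hI : ∀ i j l : Fin n, i ≤ j → j ≤ l → ∀ v : V, v ∈ W i → v ∈ W l → v ∈ W j) :
    ∀ (h : ℕ) (l : List Bool), 0 < h → l.length + h ≤ d →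
      ∃ i, h + 1 ≤ 2 * ((W i).filter (· ∈ subT B h l)).card
  | 0, l, h0, _ => absurd h0 (by omega)
  | 1, l, _, hl => by
    obtain ⟨y, hy⟩ := hM.ne l (by omega)
    obtain ⟨i, hi⟩ := hV y
    refine ⟨i, ?_⟩
    have : 0 < ((W i).filter (· ∈ subT B 1 l)).card :=
      Finset.card_pos.2 ⟨y, Finset.mem_filter.2 ⟨hi, Or.inl (Or.inl hy)⟩⟩
    omega
  | 2, l, _, hl => by
    obtain ⟨u, hu, v, hv, ha⟩ := hM.edge l false (by omega)
    obtain ⟨i, hi, hi'⟩ := hE _ _ ha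
    refine ⟨i, ?_⟩
    have : ({u, v} : Finset V) ⊆ (W i).filter (· ∈ subT B 2 l) := by
      intro w hw
      rcases Finset.mem_insert.1 hw with rfl | hw
      · exact Finset.mem_filter.2 ⟨hi, Or.inl (Or.inl hu)⟩
      · rw [Finset.mem_singleton] at hw
        subst hw
        exact Finset.mem_filter.2 ⟨hi', Or.inl (Or.inr (Or.inl (Or.inl hv)))⟩
    have := Finset.card_le_card this
    rw [Finset.card_pair ha.ne] at this
    omega
  | h + 3, l, _, hl => by
    have ih := fun l' hl' => lower hM hV hE hI (h + 1) l' (by omega) hl'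
    let a := false :: l
    let b := true :: l
    let r : Fin 3 → List Bool := ![false :: a, true :: a, false :: b]
    have hr : ∀ k, (r k).length = l.length + 2 := by
      intro k; fin_cases k <;> simp [r, a, b]
    let K : Set V := B a ∪ (B l ∪ B b)
    obtain ⟨u1, hu1, v1, hv1, a1⟩ := hM.edge l false (by omega)
    obtain ⟨u2, hu2, v2, hv2, a2⟩ := hM.edge l true (by omega)
    have hla : a.length = l.length + 1 := by simp [a]
    have hlb : b.length = l.length + 1 := by simp [b]
    have hKc : Conn G K := (hM.conn a (by omega)).union_adj
      ((hM.conn l (by omega)).union_adj (hM.conn b (by omega)) hu2 hv2 a2) hv1 (Or.inl hu1) a1.symm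
    have hKS : ∀ k, ∃ u ∈ K, ∃ v ∈ subT B (h+1) (r k), G.Adj u v := by
      have gen : ∀ c x, c.length + 1 < d → B c ⊆ K →
          ∃ u ∈ K, ∃ v ∈ subT B (h+1) (x :: c), G.Adj u v := by
        intro c x hc hcK
        obtain ⟨u, hu, v, hv, ha⟩ := hM.edge c x hc
        exact ⟨u, hcK hu, v, Or.inl (Or.inl hv), ha⟩
      intro k
      fin_cases k
      · exact gen a false (by omega) (fun y hy => Or.inl hy)
      · exact gen a true (by omega) (fun y hy => Or.inl hy)
      · exact gen b false (by omega) (fun y hy => Or.inr (Or.inr hy))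
    have hlenlt : ∀ (m : List Bool) k, m.length < h + 1 → (m ++ r k).length < d := by
      intro m k hm
      rw [List.length_append, hr]; omega
    refine three hE hI K _ (fun k => subT B (h+1) (r k)) ?_ ?_ ?_ ?_ ?_ (h + 1) ?_
    · intro k k'
      obtain ⟨u, hu, v, hv, ha⟩ := hKS k
      obtain ⟨u', hu', v', hv', ha'⟩ := hKS k'
      exact ((subT_conn hM (h+1) (r k) (by rw [hr]; omega)).1.union_adj hKc hv hu
        ha.symm).union_adj (subT_conn hM (h+1) (r k') (by rw [hr]; omega)).1 (Or.inr hu') hv' ha'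
    · intro k
      rw [Set.disjoint_left]
      intro y hyK hy
      obtain ⟨m, hm, hy⟩ := subT_mem _ _ _ hy
      have gen : ∀ c : List Bool, c.length < l.length + 2 → y ∉ B c := by
        intro c hc hyc
        refine Set.disjoint_left.1 (hM.disj c _ (by omega) (hlenlt m k hm) ?_) hyc hy
        rintro rfl
        rw [List.length_append, hr] at hc
        omega
      rcases hyK with h' | h' | h'
      · exact gen a (by omega) h'
      · exact gen l (by omega) h'
      · exact gen b (by omega) h'
    · intro k k' hne
      rw [Set.disjoint_left]
      intro y hy hy'
      obtain ⟨m, hm, hy⟩ := subT_mem _ _ _ hy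
      obtain ⟨m', hm', hy'⟩ := subT_mem _ _ _ hy'
      refine Set.disjoint_left.1 (hM.disj _ _ (hlenlt m k hm) (hlenlt m' k' hm') ?_) hy hy'
      intro heq
      have := (List.append_inj' heq (by rw [hr, hr])).2
      revert hne this
      fin_cases k <;> fin_cases k' <;> simp [r, a, b]
    · intro k y hy
      fin_cases k
      · exact Or.inl (Or.inr (Or.inl (Or.inr hy)))
      · exact Or.inl (Or.inr (Or.inr hy))
      · exact Or.inr (Or.inl (Or.inr hy))
    · rintro y (h' | h' | h')
      · exact Or.inl (Or.inr (Or.inl (Or.inl h')))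
      · exact Or.inl (Or.inl h')
      · exact Or.inr (Or.inl (Or.inl h'))
    · intro k
      exact ih (r k) (by rw [hr]; omega)

end

/-- Robertson–Seymour: excluding a subdivision of the uniform binary tree `H_d` bounds
path-width; conversely a graph containing a subdivision of `H_d` has path-width at least
`(d-1)/2`. -/
theorem pathwidth_iff_excluded_binTree (d : ℕ) (hd : 2 ≤ d) :
    (∃ k : ℕ, ∀ (V : Type) [Fintype V], ∀ G : SimpleGraph V,
      ¬ HasSubdivision G (binTree d) → PathwidthAtMost G k) ∧
    (∀ (V : Type) [Fintype V], ∀ G : SimpleGraph V,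
      HasSubdivision G (binTree d) → ∀ m : ℕ, PathwidthAtMost G m → d - 1 ≤ 2 * m) := by
  constructor
  · refine ⟨2 ^ d - 1, fun V _ G hG => ?_⟩
    apply Adm.pathwidth
    have : 2 ^ d - 1 + 1 = 2 ^ d := Nat.sub_add_cancel Nat.one_le_two_pow
    rw [this]
    by_contra h
    obtain ⟨B, hB⟩ := exists_model G d h
    exact hG (hB.hasSubdivision (by omega))
  · intro V _ G hG m hm
    obtain ⟨n, W, h1, h2, h3, h4⟩ := hm
    obtain ⟨B, hB⟩ := hG.model
    obtain ⟨i, hi⟩ := lower hB h2 h3 h4 d [] (by omega) (by simp)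
    classical
    have := h1 i
    have := Finset.card_filter_le (W i) (· ∈ subT B d [])
    have e : 2 * ((W i).filter (· ∈ subT B d [])).card ≥ d + 1 := by convert hi
    omega
end
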